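/- Let X be a locally finite building, let G be a closed subgroup of Aut(X), let ξ ∈ Cr(X), and let G_ξ be the stabiliser of ξ in G. Then the set P of periodic elements of G_ξ coincides with ⋃_{x ∈ Res(X)} Fix_G(Q(x,ξ)), the union of the pointwise fixators of the combinatorial sectors pointing to ξ; P is a subgroup of G_ξ which is normal, topologically locally finite, and contains every topologically locally finite subgroup of G_ξ (so P is the locally finite radical of G_ξ). Moreover, for any apartment A containing a sequence of spherical residues converging to ξ, P = ⋃_{x ∈ Res(X), x lying in A} Fix_G(Q(x,ξ)). -/

import Mathlib

open Filter Topology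

noncomputable section

variable {B : Type} {W : Type} [Group W] {M : CoxeterMatrix B}

/-- The subset `I` of the simple reflections is of *spherical type* if the standard
parabolic subgroup `W_I` it generates is finite. -/
def SphType (cs : CoxeterSystem M W) (I : Set B) : Prop :=
  ((Subgroup.closure (cs.simple '' I) : Subgroup W) : Set W).Finite

/-- A building of type `(W,S)`, in the chamber-system (`W`-metric) approach:
a nonempty set of chambers with a Weyl-group-valued distance function `delta`. -/
structure Bldg (cs : CoxeterSystem M W) where
  Chamber : Type
  chamber_nonempty : Nonempty Chamber
  delta : Chamber → Chamber → W
  delta_eq_one_iff : ∀ C D, delta C D = 1 ↔ C = D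
  delta_mem_pair : ∀ C D E (i : B), delta D E = cs.simple i →
    delta C E = delta C D * cs.simple i ∨ delta C E = delta C D
  delta_eq_of_length : ∀ C D E (i : B), delta D E = cs.simple i →
    cs.length (delta C D * cs.simple i) = cs.length (delta C D) + 1 →
    delta C E = delta C D * cs.simple i
  exists_delta : ∀ C D (i : B), ∃ E, delta D E = cs.simple i ∧
    delta C E = delta C D * cs.simple i

namespace Bldg

variable {cs : CoxeterSystem M W} (X : Bldg cs)

instance : Nonempty X.Chamber := X.chamber_nonempty

instance : TopologicalSpace X.Chamber := ⊥
instance : DiscreteTopology X.Chamber := ⟨rfl⟩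

/-- The gallery distance between two chambers. -/
def gdist (C D : X.Chamber) : ℕ := cs.length (X.delta C D)

/-- The `I`-residue of the chamber `C`. -/
def residue (I : Set B) (C : X.Chamber) : Set X.Chamber :=
  {D | X.delta C D ∈ Subgroup.closure (cs.simple '' I)}

/-- `R` is a spherical residue. -/
def IsSphResidue (R : Set X.Chamber) : Prop :=
  ∃ (I : Set B) (C : X.Chamber), SphType cs I ∧ R = X.residue I C

/-- `R` is a panel, i.e. an `{s}`-residue. -/
def IsPanel (R : Set X.Chamber) : Prop :=
  ∃ (i : B) (C : X.Chamber), R = X.residue {i} C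

/-- The set `Res(X)` of spherical residues of `X`. -/
def Res : Type := {R : Set X.Chamber // X.IsSphResidue R}

/-- The set of panels of `X`. -/
def Panel : Type := {R : Set X.Chamber // X.IsPanel R}

instance : Nonempty X.Res := by
  obtain ⟨C⟩ := X.chamber_nonempty
  exact ⟨⟨X.residue ∅ C, ∅, C, by simp [SphType], rfl⟩⟩

instance : TopologicalSpace X.Res := ⊥
instance : DiscreteTopology X.Res := ⟨rfl⟩

/-- `R₁ ≤ R₂` : the spherical residue `R₂` contains `R₁`, i.e. `R₂ ⊆ R₁` as
sets of chambers. -/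
def leRes (R₁ R₂ : X.Res) : Prop := R₂.1 ⊆ R₁.1

/-- The star `St(σ)` of a spherical residue. -/
def star (σ : X.Res) : Set X.Res := {τ | X.leRes σ τ}

/-- The gate (combinatorial projection) of the chamber `C` onto the residue `R` :
the unique chamber of `R` through which pass minimal galleries from `C` to any
chamber of `R`. -/
def gate (R : Set X.Chamber) (C : X.Chamber) : X.Chamber :=
  Classical.epsilon fun D => D ∈ R ∧ ∀ E ∈ R, X.gdist C E = X.gdist C D + X.gdist D E

/-- The combinatorial projection of the residue `T` onto the residue `R`,
as a set of chambers. -/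
def projSet (R T : Set X.Chamber) : Set X.Chamber := X.gate R '' T

/-- The combinatorial projection `proj_R(T)` of the spherical residue `T` onto
the spherical residue `R`, as a spherical residue. -/
def projRes (R T : X.Res) : X.Res :=
  Classical.epsilon fun U : X.Res => U.1 = X.projSet R.1 T.1

/-- The map `proj_r : Res(X) → ∏_σ St(σ)` underlying the maximal combinatorial
bordification. -/
def projr (R : X.Res) : X.Res → X.Res := fun σ => X.projRes σ R

/-- The maximal combinatorial bordification `Cr(X)`: the closure of the image
of `proj_r`, each factor of the product being discrete. -/
def Cr : Set (X.Res → X.Res) := closure (Set.range X.projr)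

/-- The map `proj_c : ch(X) → ∏_{σ panel} St(σ)` underlying the minimal
combinatorial bordification. -/
def projc (C : X.Chamber) : X.Panel → X.Chamber := fun σ => X.gate σ.1 C

/-- The minimal combinatorial bordification `Cc(X)`. -/
def Cc : Set (X.Panel → X.Chamber) := closure (Set.range X.projc)

/-- A set of spherical residues is closed if it contains, with any residue,
all residues that it contains (in the order `leRes`). -/
def ClosedResSet (𝓡 : Set X.Res) : Prop :=
  ∀ R₁ R₂ : X.Res, X.leRes R₁ R₂ → R₂ ∈ 𝓡 → R₁ ∈ 𝓡

/-- A set of spherical residues is convex if it is closed and stable under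
combinatorial projections. -/
def ConvexResSet (𝓡 : Set X.Res) : Prop :=
  X.ClosedResSet 𝓡 ∧ ∀ R₁ ∈ 𝓡, ∀ R₂ ∈ 𝓡, X.projRes R₁ R₂ ∈ 𝓡

/-- The closure of a set of spherical residues. -/
def resClosure (𝓡 : Set X.Res) : Set X.Res := ⋂₀ {𝓢 | X.ClosedResSet 𝓢 ∧ 𝓡 ⊆ 𝓢}

/-- The convex hull of a set of spherical residues. -/
def convHull (𝓡 : Set X.Res) : Set X.Res := ⋂₀ {𝓢 | X.ConvexResSet 𝓢 ∧ 𝓡 ⊆ 𝓢}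

/-- The convex hull `Conv(R₁,R₂)` of two spherical residues. -/
def conv2 (R₁ R₂ : X.Res) : Set X.Res := X.convHull {R₁, R₂}

/-- `α : W → ch(X)` is an apartment map: an isometric embedding of the Coxeter
complex. -/
def IsApartMap (α : W → X.Chamber) : Prop :=
  Function.Injective α ∧ ∀ v w : W, X.delta (α v) (α w) = v⁻¹ * w

/-- `A` is an apartment of `X`. -/
def IsApartment (A : Set X.Chamber) : Prop :=
  ∃ α : W → X.Chamber, X.IsApartMap α ∧ A = Set.range α

/-- The residue `R` lies in the apartment `A`. -/
def LiesIn (R : X.Res) (A : Set X.Chamber) : Prop := (R.1 ∩ A).Nonempty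

/-- `φ` is a root (half-apartment) of the apartment `A`. -/
def IsRootOf (A φ : Set X.Chamber) : Prop :=
  ∃ α : W → X.Chamber, X.IsApartMap α ∧ A = Set.range α ∧
    ∃ t : W, cs.IsReflection t ∧ φ = α '' {v : W | cs.length v < cs.length (t * v)}

/-- The residue `R` is contained in the root `φ` of the apartment `A`. -/
def ContainedInRoot (R : X.Res) (A φ : Set X.Chamber) : Prop := R.1 ∩ A ⊆ φ

/-- `Φ_A(R₁,R₂)`: the set of roots of `A` containing `R₁` but not `R₂`. -/
def PhiSep (A : Set X.Chamber) (R₁ R₂ : X.Res) : Set (Set X.Chamber) :=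
  {φ | X.IsRootOf A φ ∧ X.ContainedInRoot R₁ A φ ∧ ¬ X.ContainedInRoot R₂ A φ}

/-- A choice of apartment in which both `R₁` and `R₂` lie. -/
def chooseApt (R₁ R₂ : X.Res) : Set X.Chamber :=
  Classical.epsilon fun A : Set X.Chamber => X.IsApartment A ∧ X.LiesIn R₁ A ∧ X.LiesIn R₂ A

/-- The root-distance between two spherical residues:
`d(R₁,R₂) = ½|Φ_A(R₁,R₂)| + ½|Φ_A(R₂,R₁)|` for an apartment `A` containing both. -/
def rootDist (R₁ R₂ : X.Res) : ℝ :=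
  (((X.PhiSep (X.chooseApt R₁ R₂) R₁ R₂).ncard +
    (X.PhiSep (X.chooseApt R₁ R₂) R₂ R₁).ncard : ℕ) : ℝ) / 2

/-- The interval `[R₁,R₂]` determined by two spherical residues. -/
def interval (R₁ R₂ : X.Res) : Set X.Res :=
  {σ | X.rootDist R₁ R₂ = X.rootDist R₁ σ + X.rootDist σ R₂}

/-- The retraction onto the apartment given by the apartment map `α`, centred at
the chamber `α 1`. -/
def retr (α : W → X.Chamber) (D : X.Chamber) : X.Chamber := α (X.delta (α 1) D)

/-- The retraction onto an apartment, acting on spherical residues: it maps the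
`I`-residue of a chamber `D` to the `I`-residue of the retracted chamber. -/
def retrRes (α : W → X.Chamber) (R : X.Res) : X.Res :=
  Classical.epsilon fun T : X.Res =>
    ∃ (I : Set B) (D : X.Chamber), R.1 = X.residue I D ∧ T.1 = X.residue I (X.retr α D)

/-- The sequence `(R_n)` of spherical residues converges to `ξ` in the maximal
combinatorial bordification. -/
def ConvSeq (ξ : X.Res → X.Res) (R : ℕ → X.Res) : Prop :=
  Tendsto (fun n => X.projr (R n)) atTop (nhds ξ)

/-- `Q(x, (R_n)) = ⋃_k ⋂_{n ≥ k} Conv(x, R_n)`. -/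
def Qseq (x : X.Res) (R : ℕ → X.Res) : Set X.Res :=
  ⋃ k : ℕ, ⋂ n : ℕ, ⋂ _ : k ≤ n, X.conv2 x (R n)

/-- The combinatorial sector `Q(x,ξ)` based at `x` and pointing towards `ξ`. -/
def Qsector (x : X.Res) (ξ : X.Res → X.Res) : Set X.Res :=
  X.Qseq x (Classical.epsilon (X.ConvSeq ξ))

/-- `Φ_A(ξ)`: the set of roots of the apartment `A` (with apartment map `α`) in
which every sequence of residues converging to `ξ`, retracted to `A`, eventually
lies. -/
def PhiXi (A : Set X.Chamber) (α : W → X.Chamber) (ξ : X.Res → X.Res) :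
    Set (Set X.Chamber) :=
  {φ | X.IsRootOf A φ ∧ ∀ R : ℕ → X.Res, X.ConvSeq ξ R →
    ∃ N : ℕ, ∀ n > N, X.ContainedInRoot (X.retrRes α (R n)) A φ}

/-- `Φ_A(x)`: the set of roots of `A` containing the residue `x`. -/
def PhiRes (A : Set X.Chamber) (x : X.Res) : Set (Set X.Chamber) :=
  {φ | X.IsRootOf A φ ∧ X.ContainedInRoot x A φ}

/-- The spherical residue `x` is a chamber (an `∅`-residue). -/
def IsChamberRes (x : X.Res) : Prop :=
  ∃ C : X.Chamber, x.1 = X.residue (∅ : Set B) C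

/-- The automorphism group of the building: all permutations of the chambers
preserving the Weyl distance. -/
def autGroup : Subgroup (Equiv.Perm X.Chamber) where
  carrier := {g | ∀ C D : X.Chamber, X.delta (g C) (g D) = X.delta C D}
  one_mem' := by intro C D; simp
  mul_mem' := by
    intro a b ha hb C D
    simp only [Equiv.Perm.mul_apply]
    rw [ha, hb]
  inv_mem' := by
    intro a ha C D
    have := ha (a⁻¹ C) (a⁻¹ D)
    simpa using this.symm

/-- `Aut(X)` as a type. -/
abbrev Aut : Type := ↥X.autGroup

/-- The topology of pointwise convergence on `Aut(X)` (the chamber set being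
discrete). -/
instance : TopologicalSpace X.Aut :=
  TopologicalSpace.induced
    (fun g : X.Aut => ((g : Equiv.Perm X.Chamber) : X.Chamber → X.Chamber)) inferInstance

/-- The action of an automorphism on spherical residues. -/
def actRes (g : X.Aut) (R : X.Res) : X.Res :=
  Classical.epsilon fun T : X.Res => T.1 = (g : Equiv.Perm X.Chamber) '' R.1

/-- The action of an automorphism on panels. -/
def actPanel (g : X.Aut) (σ : X.Panel) : X.Panel :=
  haveI : Nonempty X.Panel := ⟨σ⟩
  Classical.epsilon fun τ : X.Panel => τ.1 = (g : Equiv.Perm X.Chamber) '' σ.1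

/-- The action of `Aut(X)` on the maximal combinatorial bordification:
`(g·f)(σ) = g·f(g⁻¹σ)`. -/
def actCr (g : X.Aut) (f : X.Res → X.Res) : X.Res → X.Res :=
  fun σ => X.actRes g (f (X.actRes g⁻¹ σ))

/-- The action of `Aut(X)` on the minimal combinatorial bordification. -/
def actCc (g : X.Aut) (f : X.Panel → X.Chamber) : X.Panel → X.Chamber :=
  fun σ => (g : Equiv.Perm X.Chamber) (f (X.actPanel g⁻¹ σ))

/-- The building is locally finite: `S` is finite and panels are finite. -/
def LocallyFinite : Prop :=
  Finite B ∧ ∀ R : Set X.Chamber, X.IsPanel R → R.Finite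

/-- The building is thick: every panel contains at least three chambers. -/
def Thick : Prop := ∀ R : Set X.Chamber, X.IsPanel R → 3 ≤ R.ncard

/-- The subgroup `G ≤ Aut(X)` acts strongly transitively: transitively on pairs
`(C, A)` of a chamber contained in an apartment. -/
def StronglyTransitive (G : Subgroup X.Aut) : Prop :=
  ∀ (C C' : X.Chamber) (A A' : Set X.Chamber),
    X.IsApartment A → C ∈ A → X.IsApartment A' → C' ∈ A' →
    ∃ g ∈ G, (g : Equiv.Perm X.Chamber) C = C' ∧ (g : Equiv.Perm X.Chamber) '' A = A'

end Bldg

/-- A topological group is amenable if there is a left-invariant mean on the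
space of bounded continuous real-valued functions on it. -/
def IsAmenableGroup (H : Type*) [Group H] [TopologicalSpace H] : Prop :=
  ∃ m : BoundedContinuousFunction H ℝ →ₗ[ℝ] ℝ,
    m 1 = 1 ∧ (∀ f : BoundedContinuousFunction H ℝ, (∀ x, 0 ≤ f x) → 0 ≤ m f) ∧
    ∀ (g : H) (f₁ f₂ : BoundedContinuousFunction H ℝ),
      (∀ x, f₂ x = f₁ (g * x)) → m f₂ = m f₁

/-- A subset `K` of a topological group is topologically locally finite if every
finite subset of `K` generates a subgroup with compact closure. -/
def IsTLFSet {H : Type*} [Group H] [TopologicalSpace H] (K : Set H) : Prop :=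
  ∀ s : Finset H, (s : Set H) ⊆ K →
    IsCompact (closure ((Subgroup.closure (s : Set H) : Subgroup H) : Set H))

/-- The space of closed subgroups of a topological group. -/
def ChabautySpace (H : Type*) [Group H] [TopologicalSpace H] : Type _ :=
  {K : Subgroup H // IsClosed (K : Set H)}

instance {H : Type*} [Group H] [TopologicalSpace H] : Nonempty (ChabautySpace H) :=
  ⟨⟨⊤, by rw [Subgroup.coe_top]; exact isClosed_univ⟩⟩

/-- The Chabauty topology on the space of closed subgroups. -/
instance {H : Type*} [Group H] [TopologicalSpace H] : TopologicalSpace (ChabautySpace H) :=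
  TopologicalSpace.generateFrom
    ({s | ∃ K : Set H, IsCompact K ∧ s = {L : ChabautySpace H | (L.1 : Set H) ∩ K = ∅}} ∪
     {s | ∃ U : Set H, IsOpen U ∧ s = {L : ChabautySpace H | ((L.1 : Set H) ∩ U).Nonempty}})

namespace Bldg

variable {cs : CoxeterSystem M W} (X : Bldg cs)

/-- The stabiliser in `G` of a spherical residue, as a set. -/
def gstab (G : Subgroup X.Aut) (R : X.Res) : Set ↥G :=
  {g : ↥G | X.actRes (g : X.Aut) R = R}

/-- The stabiliser in `G` of a spherical residue, as a closed subgroup of `G`. -/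
def gstabC (G : Subgroup X.Aut) (R : X.Res) : ChabautySpace ↥G :=
  Classical.epsilon fun L : ChabautySpace ↥G => (L.1 : Set ↥G) = X.gstab G R

/-- `D_ξ`: the union over `x ∈ Res(X)` of the pointwise fixators in `G` of the
combinatorial sectors `Q(x,ξ)`. -/
def gfixSector (G : Subgroup X.Aut) (ξ : X.Res → X.Res) : Set ↥G :=
  {g : ↥G | ∃ x : X.Res, ∀ R ∈ X.Qsector x ξ, X.actRes (g : X.Aut) R = R}

/-- `D_ξ` as a closed subgroup of `G` (an element of the Chabauty space). -/
def DxiC (G : Subgroup X.Aut) (ξ : X.Res → X.Res) : ChabautySpace ↥G :=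
  Classical.epsilon fun L : ChabautySpace ↥G => (L.1 : Set ↥G) = X.gfixSector G ξ

/-- The set of periodic elements of the stabiliser `G_ξ`. -/
def periodicStab (G : Subgroup X.Aut) (ξ : X.Res → X.Res) : Set ↥G :=
  {g : ↥G | X.actCr (g : X.Aut) ξ = ξ ∧
    IsCompact (closure ((Subgroup.zpowers g : Subgroup ↥G) : Set ↥G))}

/-- The horofunction compactification of the chamber graph, with base point `y₀`. -/
def horoCh (y₀ : X.Chamber) : Set (X.Chamber → ℝ) :=
  closure (Set.range fun C : X.Chamber =>
    fun y : X.Chamber => (X.gdist C y : ℝ) - (X.gdist C y₀ : ℝ))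

/-- The horofunction compactification of `(Res(X), root-distance)`, with base
point `z₀`. -/
def horoRes (z₀ : X.Res) : Set (X.Res → ℝ) :=
  closure (Set.range fun R : X.Res =>
    fun y : X.Res => X.rootDist R y - X.rootDist R z₀)

/-- The action of `Aut(X)` on horofunctions of the chamber graph. -/
def actHoroCh (y₀ : X.Chamber) (g : X.Aut) (h : X.Chamber → ℝ) : X.Chamber → ℝ :=
  fun y => h (((g⁻¹ : X.Aut) : Equiv.Perm X.Chamber) y) -
    h (((g⁻¹ : X.Aut) : Equiv.Perm X.Chamber) y₀)

/-- The action of `Aut(X)` on horofunctions of `(Res(X), root-distance)`. -/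
def actHoroRes (z₀ : X.Res) (g : X.Aut) (h : X.Res → ℝ) : X.Res → ℝ :=
  fun y => h (X.actRes g⁻¹ y) - h (X.actRes g⁻¹ z₀)

end Bldg

namespace CoxeterSystem

variable (cs : CoxeterSystem M W)

theorem _root_.Function.End.mul_apply {α : Type*} (f g : Function.End α) (x : α) :
    (f * g) x = f (g x) := rfl

theorem _root_.Function.End.one_apply {α : Type*} (x : α) : (1 : Function.End α) x = x := rfl

open Classical in
/-- The affine action of a simple reflection on the functions `W → ZMod 2`, whose linear part is
conjugation and whose translation part is the indicator function of the reflection. -/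
def inversionStep (i : B) : Function.End (W → ZMod 2) := fun f t =>
  (if t = cs.simple i then 1 else 0) + f (cs.simple i * t * cs.simple i)

open Classical in
theorem prod_map_inversionStep_apply (ω : List B) (f : W → ZMod 2) (t : W) :
    (ω.map cs.inversionStep).prod f t =
      ((cs.leftInvSeq ω).count t : ZMod 2) + f ((cs.wordProd ω)⁻¹ * t * cs.wordProd ω) := by
  induction ω generalizing t with
  | nil => simp [Function.End.one_apply]
  | cons i ω ih =>
    rw [List.map_cons, List.prod_cons, Function.End.mul_apply, inversionStep, ih,
      leftInvSeq, List.count_cons, wordProd_cons]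
    have h1 : List.count t (List.map (MulAut.conj (cs.simple i)) (cs.leftInvSeq ω)) =
        List.count (cs.simple i * t * cs.simple i) (cs.leftInvSeq ω) := by
      have : t = MulAut.conj (cs.simple i) (cs.simple i * t * cs.simple i) := by
        simp [mul_assoc]
      conv_lhs => rw [this]
      exact List.count_map_of_injective _ _ (MulAut.conj (cs.simple i)).injective _
    rw [h1]
    simp only [beq_iff_eq, mul_inv_rev, inv_simple, mul_assoc, Nat.cast_add, Nat.cast_ite, Nat.cast_one,
      Nat.cast_zero, eq_comm (a := t)]
    ring

theorem isLiftable_inversionStep : M.IsLiftable cs.inversionStep := by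
  classical
  intro i j
  have hw : ∀ m, (cs.inversionStep i * cs.inversionStep j) ^ m =
      ((alternatingWord i j (2 * m)).map cs.inversionStep).prod := by
    intro m
    induction m with
    | zero => simp [alternatingWord]
    | succ m ih =>
      rw [pow_succ, ih, show 2 * (m + 1) = 2 * m + 1 + 1 by ring, alternatingWord_succ,
        alternatingWord_succ]
      simp
  rw [hw]
  funext f t
  rw [prod_map_inversionStep_apply]
  have h1 : cs.wordProd (alternatingWord i j (2 * M i j)) = 1 := by
    rw [prod_alternatingWord_eq_mul_pow]
    simp
  have h2 : (cs.leftInvSeq (alternatingWord i j (2 * M i j))).take (M i j) =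
      (cs.leftInvSeq (alternatingWord i j (2 * M i j))).drop (M i j) := by
    apply List.ext_getElem
    · simp; omega
    intro k h h'
    simp only [List.length_take, length_leftInvSeq, length_alternatingWord, List.length_drop] at h h'
    rw [List.getElem_take, List.getElem_drop, getElem_leftInvSeq_alternatingWord _ _ _ _ _ (by omega),
      getElem_leftInvSeq_alternatingWord _ _ _ _ _ (by omega)]
    rw [prod_alternatingWord_eq_mul_pow, prod_alternatingWord_eq_mul_pow]
    have e1 : (2 * k + 1) / 2 = k := by omega
    have e2 : (2 * (M i j + k) + 1) / 2 = M i j + k := by omega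
    rw [e1, e2, pow_add]
    simp
  rw [h1, ← List.take_append_drop (M i j) (cs.leftInvSeq _), List.count_append, ← h2]
  simp [CharTwo.add_self_eq_zero, Function.End.one_apply]

/-- The inversion cocycle of a Coxeter system. -/
def eta (w t : W) : ZMod 2 := cs.lift ⟨cs.inversionStep, cs.isLiftable_inversionStep⟩ w 0 t

theorem lift_inversionStep_wordProd (ω : List B) :
    cs.lift ⟨cs.inversionStep, cs.isLiftable_inversionStep⟩ (cs.wordProd ω) =
      (ω.map cs.inversionStep).prod := by
  rw [wordProd, map_list_prod, List.map_map]
  congr 2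
  funext i
  exact cs.lift_apply_simple _ i

open Classical in
theorem eta_wordProd (ω : List B) (t : W) :
    cs.eta (cs.wordProd ω) t = ((cs.leftInvSeq ω).count t : ZMod 2) := by
  rw [eta, lift_inversionStep_wordProd, prod_map_inversionStep_apply]
  simp

theorem eta_mul (u v t : W) : cs.eta (u * v) t = cs.eta u t + cs.eta v (u⁻¹ * t * u) := by
  classical
  obtain ⟨ω, rfl⟩ := cs.wordProd_surjective u
  obtain ⟨ω', rfl⟩ := cs.wordProd_surjective v
  rw [eta_wordProd, eta, map_mul, lift_inversionStep_wordProd, Function.End.mul_apply,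
    prod_map_inversionStep_apply, eta]

open Classical in
theorem eta_simple (i : B) (t : W) : cs.eta (cs.simple i) t = if t = cs.simple i then 1 else 0 := by
  have := cs.eta_wordProd [i] t
  rw [wordProd_singleton] at this
  rw [this, leftInvSeq_singleton, List.count_singleton]
  simp only [beq_iff_eq, eq_comm (a := t)]
  split_ifs <;> simp

theorem eta_one (t : W) : cs.eta 1 t = 0 := by
  simpa using cs.eta_wordProd [] t

theorem eta_inv (w t : W) : cs.eta w⁻¹ t = cs.eta w (w * t * w⁻¹) := by
  have h := cs.eta_mul w⁻¹ w t
  rw [inv_mul_cancel, eta_one, inv_inv] at h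
  generalize cs.eta w⁻¹ t = a at *
  generalize cs.eta w (w * t * w⁻¹) = b at *
  revert a b; decide

theorem eta_self {t : W} (ht : cs.IsReflection t) : cs.eta t t = 1 := by
  obtain ⟨w, i, rfl⟩ := ht
  have e1 : w⁻¹ * (w * cs.simple i * w⁻¹) * w = cs.simple i := by group
  have e2 : w * ((w * cs.simple i)⁻¹ * (w * cs.simple i * w⁻¹) * (w * cs.simple i)) * w⁻¹ =
      w * cs.simple i * w⁻¹ := by group
  rw [eta_mul, eta_mul, eta_inv, eta_simple, e1, e2, if_pos rfl]
  generalize cs.eta w _ = a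
  revert a; decide

theorem eta_zero_or_one (w t : W) : cs.eta w t = 0 ∨ cs.eta w t = 1 := by
  generalize cs.eta w t = a
  revert a; decide

theorem isLeftInversion_of_eta {w t : W} (h : cs.eta w t = 1) : cs.IsLeftInversion w t := by
  classical
  obtain ⟨ω, hω, rfl⟩ := cs.exists_isReduced w
  apply cs.isLeftInversion_of_mem_leftInvSeq hω
  rw [eta_wordProd] at h
  by_contra h'
  rw [List.count_eq_zero_of_not_mem h'] at h
  simp at h

theorem isLeftInversion_iff_eta {w t : W} : cs.IsLeftInversion w t ↔ cs.eta w t = 1 := by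
  refine ⟨fun h => ?_, cs.isLeftInversion_of_eta⟩
  rcases cs.eta_zero_or_one w t with h0 | h1
  · have h2 : cs.eta (t * w) t = 1 := by
      rw [eta_mul, eta_self cs h.1]
      simp [h0]
    have h3 := (cs.isLeftInversion_of_eta h2).2
    rw [← mul_assoc, h.1.mul_self, one_mul] at h3
    exact absurd h.2 (by omega)
  · exact h1

/-- The set of left inversions of `w`. -/
def leftInv (w : W) : Set W := {t | cs.IsLeftInversion w t}

theorem mem_leftInv {w t : W} : t ∈ cs.leftInv w ↔ cs.eta w t = 1 := cs.isLeftInversion_iff_eta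

theorem leftInv_wordProd {ω : List B} (hω : cs.IsReduced ω) :
    cs.leftInv (cs.wordProd ω) = {t | t ∈ cs.leftInvSeq ω} := by
  classical
  ext t
  refine ⟨fun h => ?_, fun h => cs.isLeftInversion_of_mem_leftInvSeq hω h⟩
  rw [mem_leftInv, eta_wordProd] at h
  by_contra h'
  rw [List.count_eq_zero_of_not_mem h'] at h
  simp at h

theorem finite_leftInv (w : W) : (cs.leftInv w).Finite := by
  obtain ⟨ω, hω, rfl⟩ := cs.exists_isReduced w
  rw [cs.leftInv_wordProd hω]
  exact List.finite_toSet _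

theorem ncard_leftInv (w : W) : (cs.leftInv w).ncard = cs.length w := by
  classical
  obtain ⟨ω, hω, rfl⟩ := cs.exists_isReduced w
  rw [cs.leftInv_wordProd hω, hω.eq, ← cs.length_leftInvSeq ω,
    ← List.toFinset_card_of_nodup hω.nodup_leftInvSeq, ← Set.ncard_coe_finset]
  congr 1
  ext t
  simp

theorem mem_leftInv_mul {u v t : W} :
    t ∈ cs.leftInv (u * v) ↔ ¬ (t ∈ cs.leftInv u ↔ u⁻¹ * t * u ∈ cs.leftInv v) := by
  rw [mem_leftInv, mem_leftInv, mem_leftInv, eta_mul]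
  generalize cs.eta u t = a
  generalize cs.eta v _ = b
  revert a b; decide

theorem simple_mem_leftInv {w : W} {i : B} :
    cs.simple i ∈ cs.leftInv w ↔ cs.length (cs.simple i * w) < cs.length w :=
  ⟨fun h => h.2, fun h => ⟨cs.isReflection_simple i, h⟩⟩

theorem mem_leftInv_simple {i : B} {t : W} : t ∈ cs.leftInv (cs.simple i) ↔ t = cs.simple i := by
  classical
  rw [mem_leftInv, eta_simple]
  split_ifs with h <;> simp [h]

/-- The product `u * v` is reduced: the lengths add up. -/
def Red (u v : W) : Prop := cs.length (u * v) = cs.length u + cs.length v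

theorem red_iff_disjoint {u v : W} :
    cs.Red u v ↔ ∀ t ∈ cs.leftInv u, u⁻¹ * t * u ∉ cs.leftInv v := by
  classical
  set V : Set W := (fun t => u * t * u⁻¹) '' cs.leftInv v with hV
  have hmem : ∀ t, t ∈ V ↔ u⁻¹ * t * u ∈ cs.leftInv v := by
    intro t
    constructor
    · rintro ⟨x, hx, rfl⟩
      simpa [mul_assoc] using hx
    · intro h
      exact ⟨_, h, by simp [mul_assoc]⟩
  have hVc : V.ncard = cs.length v := by
    rw [← ncard_leftInv, hV, Set.ncard_image_of_injective]
    intro a b h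
    simpa using h
  have hVf : V.Finite := (cs.finite_leftInv v).image _
  have hs : cs.leftInv (u * v) = symmDiff (cs.leftInv u) V := by
    ext t
    rw [mem_leftInv_mul, Set.mem_symmDiff, hmem]
    tauto
  have hcard : (cs.leftInv (u * v)).ncard + 2 * (cs.leftInv u ∩ V).ncard = cs.length u + cs.length v := by
    have h1 : cs.leftInv (u * v) = (cs.leftInv u \ V) ∪ (V \ cs.leftInv u) := hs
    have d : Disjoint (cs.leftInv u \ V) (V \ cs.leftInv u) := by
      rw [Set.disjoint_left]; rintro x ⟨hx, _⟩ ⟨_, hx'⟩; exact hx' hx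
    have h2 := Set.ncard_union_eq d ((cs.finite_leftInv u).subset Set.sdiff_subset)
      (hVf.subset Set.sdiff_subset)
    have h3 := Set.ncard_inter_add_ncard_sdiff_eq_ncard (cs.leftInv u) V (cs.finite_leftInv u)
    have h4 := Set.ncard_inter_add_ncard_sdiff_eq_ncard V (cs.leftInv u) hVf
    rw [Set.inter_comm] at h4
    rw [ncard_leftInv] at h3
    rw [h1]
    omega
  rw [ncard_leftInv] at hcard
  rw [Red]
  have hf : (cs.leftInv u ∩ V).Finite := (cs.finite_leftInv u).subset Set.inter_subset_left
  constructor
  · intro h t ht htv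
    have : (cs.leftInv u ∩ V).ncard = 0 := by omega
    rw [Set.ncard_eq_zero hf] at this
    have h5 : t ∈ cs.leftInv u ∩ V := ⟨ht, (hmem t).2 htv⟩
    rw [this] at h5
    exact h5
  · intro h
    have : (cs.leftInv u ∩ V) = ∅ := by
      ext t
      simp only [Set.mem_inter_iff, Set.mem_empty_iff_false, iff_false, not_and]
      intro ht htv
      exact h t ht ((hmem t).1 htv)
    rw [this] at hcard
    simp at hcard
    exact hcard

variable {cs}

theorem Red.mem_leftInv_iff {u v t : W} (h : cs.Red u v) :
    t ∈ cs.leftInv (u * v) ↔ t ∈ cs.leftInv u ∨ u⁻¹ * t * u ∈ cs.leftInv v := by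
  rw [mem_leftInv_mul]
  have := cs.red_iff_disjoint.1 h t
  tauto

theorem Red.subset {u v : W} (h : cs.Red u v) : cs.leftInv u ⊆ cs.leftInv (u * v) :=
  fun _ ht => h.mem_leftInv_iff.2 (Or.inl ht)

variable (cs)

/-- The (right) weak order: `u` is an initial segment of a reduced expression of `w`. -/
def Wle (u w : W) : Prop := cs.Red u (u⁻¹ * w)

theorem wle_iff {u w : W} : cs.Wle u w ↔ cs.leftInv u ⊆ cs.leftInv w := by
  constructor
  · intro h
    have := h.subset
    rwa [mul_inv_cancel_left] at this
  · intro h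
    rw [Wle, red_iff_disjoint]
    intro t ht ht'
    have := h ht
    rw [show w = u * (u⁻¹ * w) by group, mem_leftInv_mul] at this
    tauto

variable {cs}

theorem Red.wle {u v : W} (h : cs.Red u v) : cs.Wle u (u * v) := cs.wle_iff.2 h.subset

theorem Wle.length_eq {u w : W} (h : cs.Wle u w) :
    cs.length w = cs.length u + cs.length (u⁻¹ * w) := by
  have : cs.length (u * (u⁻¹ * w)) = _ := h
  rwa [mul_inv_cancel_left] at this

theorem Wle.trans {u v w : W} (h : cs.Wle u v) (h' : cs.Wle v w) : cs.Wle u w :=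
  cs.wle_iff.2 ((cs.wle_iff.1 h).trans (cs.wle_iff.1 h'))

theorem Wle.antisymm {u w : W} (h : cs.Wle u w) (h' : cs.Wle w u) : u = w := by
  have h1 := h.length_eq
  have h2 := h'.length_eq
  have : cs.length (u⁻¹ * w) = 0 := by omega
  rw [length_eq_zero_iff] at this
  exact (inv_mul_eq_one.1 this)

variable (cs)

theorem wle_refl (u : W) : cs.Wle u u := cs.wle_iff.2 subset_rfl

theorem one_wle (u : W) : cs.Wle 1 u := by simp [Wle, Red]

theorem wle_of_length {u w : W} (h : cs.length u + cs.length (u⁻¹ * w) ≤ cs.length w) :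
    cs.Wle u w := by
  have := cs.length_mul_le u (u⁻¹ * w)
  rw [Wle, Red]
  rw [mul_inv_cancel_left] at *
  omega

theorem red_inv {u v : W} : cs.Red v⁻¹ u⁻¹ ↔ cs.Red u v := by
  rw [Red, Red, ← mul_inv_rev, length_inv, length_inv, length_inv, add_comm (cs.length v)]

variable {cs}

theorem Red.inv {u v : W} (h : cs.Red u v) : cs.Red v⁻¹ u⁻¹ := cs.red_inv.2 h

/-- Associativity of reduced products. -/
theorem Red.assoc_right {u v x : W} (h : cs.Red u v) (h' : cs.Red (u * v) x) :
    cs.Red v x ∧ cs.Red u (v * x) := by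
  have h1 := cs.length_mul_le v x
  have h2 := cs.length_mul_le u (v * x)
  simp only [Red, mul_assoc] at *
  omega

theorem Red.assoc_left {u v x : W} (h : cs.Red v x) (h' : cs.Red u (v * x)) :
    cs.Red u v ∧ cs.Red (u * v) x := by
  have h1 := cs.length_mul_le u v
  have h2 := cs.length_mul_le (u * v) x
  simp only [Red, mul_assoc] at *
  omega

/-- Left translation by `u` is an isomorphism of the weak order onto the set of elements above `u`,
on elements with which `u` has a reduced product. -/
theorem wle_mul_left_iff {u v w : W} (hv : cs.Red u v) (hw : cs.Red u w) :
    cs.Wle (u * v) (u * w) ↔ cs.Wle v w := by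
  rw [Wle, Wle, Red, Red, show (u * v)⁻¹ * (u * w) = v⁻¹ * w by group, mul_inv_cancel_left,
    show u * v * (v⁻¹ * w) = u * w by group]
  rw [Red] at *
  omega

/-- Intervals in the weak order are convex. -/
theorem wle_of_between {u v w x : W} (hu : cs.Wle u w) (hv : cs.Wle v w)
    (hx : cs.Red (u⁻¹ * x) (x⁻¹ * v)) : cs.Wle x w := by
  rw [wle_iff] at *
  intro t ht
  by_contra hw
  have htu : t ∉ cs.leftInv u := fun h => hw (hu h)
  have htv : t ∉ cs.leftInv v := fun h => hw (hv h)
  have h1 : u⁻¹ * t * u ∈ cs.leftInv (u⁻¹ * x) := by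
    rw [show x = u * (u⁻¹ * x) by group, mem_leftInv_mul] at ht
    tauto
  have h2 := hx.subset h1
  rw [show u⁻¹ * x * (x⁻¹ * v) = u⁻¹ * v by group] at h2
  apply htv
  rw [show v = u * (u⁻¹ * v) by group, mem_leftInv_mul]
  tauto

end CoxeterSystem

namespace CoxeterSystem

variable (cs : CoxeterSystem M W)

/-- The standard parabolic subgroup of type `J`. -/
abbrev par (J : Set B) : Subgroup W := Subgroup.closure (cs.simple '' J)

variable {cs}

theorem simple_mem_par {J : Set B} {j : B} (h : j ∈ J) : cs.simple j ∈ cs.par J :=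
  Subgroup.subset_closure ⟨j, h, rfl⟩

theorem par_mono {I J : Set B} (h : I ⊆ J) : cs.par I ≤ cs.par J :=
  Subgroup.closure_mono (Set.image_mono h)

theorem simple_mul_simple_mul (i : B) (w : W) : cs.simple i * (cs.simple i * w) = w := by simp

theorem length_simple_mul_of_mem {i : B} {w : W} (h : cs.simple i ∈ cs.leftInv w) :
    cs.length (cs.simple i * w) + 1 = cs.length w := by
  have := cs.simple_mem_leftInv.1 h
  have := cs.length_simple_mul w i
  omega

theorem length_simple_mul_of_not_mem {i : B} {w : W} (h : cs.simple i ∉ cs.leftInv w) :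
    cs.length (cs.simple i * w) = cs.length w + 1 := by
  rw [cs.simple_mem_leftInv] at h
  have := cs.length_simple_mul w i
  omega

theorem red_simple_iff {i : B} {w : W} : cs.Red (cs.simple i) w ↔ cs.simple i ∉ cs.leftInv w := by
  rw [Red, cs.simple_mem_leftInv, length_simple]
  have := cs.length_simple_mul w i
  omega

theorem exists_reduced_word_of_mem_par {J : Set B} {v : W} (hv : v ∈ cs.par J) :
    ∃ ω : List B, cs.IsReduced ω ∧ (∀ i ∈ ω, i ∈ J) ∧ v = cs.wordProd ω := by
  have key : ∀ j ∈ J, ∀ v, (∃ ω : List B, cs.IsReduced ω ∧ (∀ i ∈ ω, i ∈ J) ∧ v = cs.wordProd ω) →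
      ∃ ω : List B, cs.IsReduced ω ∧ (∀ i ∈ ω, i ∈ J) ∧ cs.simple j * v = cs.wordProd ω := by
    rintro j hj v ⟨ω, hr, hω, rfl⟩
    by_cases h : cs.simple j ∈ cs.leftInv (cs.wordProd ω)
    · have hl := length_simple_mul_of_mem h
      rw [cs.leftInv_wordProd hr] at h
      obtain ⟨k, hk, hk'⟩ := List.getElem_of_mem (show cs.simple j ∈ cs.leftInvSeq ω from h)
      have h1 := cs.getD_leftInvSeq_mul_wordProd ω k
      rw [List.getD_eq_getElem _ _ hk, hk'] at h1
      refine ⟨ω.eraseIdx k, ?_, fun i hi => hω i (List.mem_of_mem_eraseIdx hi), h1⟩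
      rw [length_leftInvSeq] at hk
      rw [IsReduced, ← h1, List.length_eraseIdx_of_lt hk]
      rw [hr.eq] at hl
      omega
    · refine ⟨j :: ω, ?_, ?_, (cs.wordProd_cons _ _).symm⟩
      · rw [IsReduced, cs.wordProd_cons, length_simple_mul_of_not_mem h, hr.eq, List.length_cons]
      · intro i hi
        rcases List.mem_cons.1 hi with rfl | hi
        · exact hj
        · exact hω i hi
  induction hv using Subgroup.closure_induction_left with
  | one => exact ⟨[], by simp [IsReduced], by simp, by simp⟩
  | mul_left x hx y _ ih =>
    obtain ⟨j, hj, rfl⟩ := hx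
    exact key j hj y ih
  | inv_mul_cancel x hx y _ ih =>
    obtain ⟨j, hj, rfl⟩ := hx
    rw [inv_simple]
    exact key j hj y ih

theorem leftInv_subset_par {J : Set B} {v : W} (hv : v ∈ cs.par J) :
    cs.leftInv v ⊆ cs.par J := by
  obtain ⟨ω, -, hω, rfl⟩ := exists_reduced_word_of_mem_par hv
  clear hv
  induction ω with
  | nil =>
    intro t ht
    rw [wordProd_nil, mem_leftInv, eta_one] at ht
    exact absurd ht (by decide)
  | cons i ω ih =>
    intro t ht
    rw [wordProd_cons, mem_leftInv_mul, mem_leftInv_simple] at ht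
    have hi : cs.simple i ∈ cs.par J := simple_mem_par (hω i (by simp))
    by_cases h : t = cs.simple i
    · rw [h]; exact hi
    · have h1 : (cs.simple i)⁻¹ * t * cs.simple i ∈ cs.par J :=
        ih (fun k hk => hω k (by simp [hk])) (by tauto)
      have h2 := mul_mem (mul_mem hi h1) (inv_mem hi)
      simpa [mul_assoc] using h2

theorem exists_descent_of_mem_par {J : Set B} {v : W} (hv : v ∈ cs.par J) (h : v ≠ 1) :
    ∃ j ∈ J, cs.simple j ∈ cs.leftInv v := by
  obtain ⟨ω, hr, hω, rfl⟩ := exists_reduced_word_of_mem_par hv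
  cases ω with
  | nil => simp at h
  | cons i ω =>
    refine ⟨i, hω i (by simp), ?_⟩
    rw [simple_mem_leftInv, hr.eq, wordProd_cons, simple_mul_simple_cancel_left]
    have := cs.length_wordProd_le ω
    simp only [List.length_cons]
    omega

theorem mem_simple_image_of_length_one {J : Set B} {v : W} (hv : v ∈ cs.par J)
    (h : cs.length v = 1) : ∃ j ∈ J, v = cs.simple j := by
  obtain ⟨j, hj, hd⟩ := exists_descent_of_mem_par hv (by rintro rfl; simp at h)
  refine ⟨j, hj, ?_⟩
  have := length_simple_mul_of_mem hd
  have h0 : cs.length (cs.simple j * v) = 0 := by omega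
  rw [length_eq_zero_iff] at h0
  have := eq_inv_of_mul_eq_one_right h0
  simpa using this

/-- Induction on the length of an element of a standard parabolic subgroup, removing letters on
the left. -/
theorem par_induction {J : Set B} {p : W → Prop} (one : p 1)
    (step : ∀ j ∈ J, ∀ v ∈ cs.par J, cs.Red (cs.simple j) v → p v → p (cs.simple j * v)) :
    ∀ v ∈ cs.par J, p v := by
  have : ∀ n, ∀ v ∈ cs.par J, cs.length v = n → p v := by
    intro n
    induction n with
    | zero =>
      intro v _ h
      rw [length_eq_zero_iff] at h
      rwa [h]
    | succ n ih =>
      intro v hv h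
      obtain ⟨j, hj, hd⟩ := exists_descent_of_mem_par hv (by rintro rfl; simp at h)
      have hl := length_simple_mul_of_mem hd
      have hm := mul_mem (simple_mem_par (cs := cs) hj) hv
      have h1 := step j hj _ hm (by
        rw [Red, simple_mul_simple_mul, length_simple]; omega) (ih _ hm (by omega))
      rwa [simple_mul_simple_mul] at h1
  exact fun v hv => this _ v hv rfl

variable (cs)

/-- `w` is the shortest element of its right coset `W_J w`. -/
def LRed (J : Set B) (w : W) : Prop := ∀ h ∈ cs.par J, cs.Red h w

/-- `w` is the shortest element of its left coset `w W_J`. -/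
def RRed (J : Set B) (w : W) : Prop := ∀ h ∈ cs.par J, cs.Red w h

variable {cs}

theorem rRed_iff {J : Set B} {w : W} : cs.RRed J w ↔ cs.LRed J w⁻¹ := by
  constructor
  · intro h x hx
    have := (h _ (inv_mem hx)).inv
    rwa [inv_inv] at this
  · intro h x hx
    have := (h _ (inv_mem hx)).inv
    rwa [inv_inv, inv_inv] at this

theorem lRed_iff {J : Set B} {w : W} : cs.LRed J w ↔ cs.RRed J w⁻¹ := by
  rw [rRed_iff, inv_inv]

theorem lRed_iff_forall_not_mem {J : Set B} {w : W} :
    cs.LRed J w ↔ ∀ t ∈ cs.par J, t ∉ cs.leftInv w := by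
  constructor
  · intro h t ht ht'
    have h1 := h t ht
    rw [Red] at h1
    have := ht'.2
    omega
  · intro h x hx
    rw [red_iff_disjoint]
    intro t ht
    exact h _ (mul_mem (mul_mem (inv_mem hx) (leftInv_subset_par hx ht)) hx)

theorem exists_eq_mul_lRed (J : Set B) (w : W) :
    ∃ h ∈ cs.par J, ∃ m, cs.LRed J m ∧ w = h * m := by
  classical
  have hne : ∃ n, ∃ h ∈ cs.par J, cs.length (h * w) = n := ⟨_, 1, one_mem _, rfl⟩
  obtain ⟨h, hh, hl⟩ := Nat.find_spec hne
  refine ⟨h⁻¹, inv_mem hh, h * w, ?_, by group⟩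
  rw [lRed_iff_forall_not_mem]
  intro t ht ht'
  refine Nat.find_min hne (m := cs.length (t * (h * w))) ?_ ⟨t * h, mul_mem ht hh, by rw [mul_assoc]⟩
  rw [← hl]
  exact ht'.2

theorem lRed_of_simple {J : Set B} {w : W} (h : ∀ j ∈ J, cs.simple j ∉ cs.leftInv w) :
    cs.LRed J w := by
  obtain ⟨x, hx, m, hm, rfl⟩ := exists_eq_mul_lRed (cs := cs) J w
  by_cases h1 : x = 1
  · simpa [h1] using hm
  · obtain ⟨j, hj, hd⟩ := exists_descent_of_mem_par hx h1
    exact absurd ((hm x hx).subset hd) (h j hj)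

theorem LRed.simple {J : Set B} {w : W} (h : cs.LRed J w) {j : B} (hj : j ∈ J) :
    cs.simple j ∉ cs.leftInv w := red_simple_iff.1 (h _ (simple_mem_par hj))

theorem rRed_of_simple {J : Set B} {w : W}
    (h : ∀ j ∈ J, cs.length (w * cs.simple j) = cs.length w + 1) : cs.RRed J w := by
  rw [rRed_iff]
  apply lRed_of_simple
  intro j hj
  rw [simple_mem_leftInv, length_inv, ← length_inv, mul_inv_rev, inv_inv, inv_simple, h j hj]
  omega

theorem LRed.mono {I J : Set B} {w : W} (h : cs.LRed J w) (hI : cs.par I ≤ cs.par J) :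
    cs.LRed I w := fun x hx => h x (hI hx)

/-- For a reflection `s ∈ W_I` shortening `w * j`, where `w` is reduced on both sides. -/
theorem conj_simple_mem {I J : Set B} {w j : W} (hw : cs.LRed I w) (hw' : cs.RRed J w) {s : B}
    (hs : s ∈ I) (hj : j ∈ cs.par J) (h : cs.simple s ∈ cs.leftInv (w * j)) :
    ∃ k ∈ J, cs.simple s * w = w * cs.simple k := by
  rw [(hw' j hj).mem_leftInv_iff] at h
  have h1 := h.resolve_left (hw.simple hs)
  have h2 := leftInv_subset_par hj h1
  have h3 : cs.length (w⁻¹ * cs.simple s * w) = 1 := by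
    have := hw' _ h2
    rw [Red, show w * (w⁻¹ * cs.simple s * w) = cs.simple s * w by group,
      hw _ (simple_mem_par hs), length_simple] at this
    omega
  obtain ⟨k, hk, e⟩ := mem_simple_image_of_length_one h2 h3
  exact ⟨k, hk, by rw [← e]; group⟩

/-- A double coset of standard parabolic subgroups contains at most one element reduced on both
sides. -/
theorem eq_of_double_coset {I J : Set B} {u u' : W} (hu : cs.LRed I u) (_hu' : cs.RRed J u)
    (hv : cs.LRed I u') (hv' : cs.RRed J u') :
    ∀ i ∈ cs.par I, ∀ l ∈ cs.par J, i * u = u' * l → u = u' := by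
  intro i hi
  refine par_induction (p := fun i => ∀ l ∈ cs.par J, i * u = u' * l → u = u') ?_ ?_ i hi
  · intro l hl h
    have h1 := hv' l hl
    rw [one_mul] at h
    have h2 := _hu' _ (inv_mem hl)
    have h3 : u * l⁻¹ = u' := by rw [h]; group
    rw [Red, h3, length_inv] at h2
    rw [Red, ← h] at h1
    have h4 : cs.length l = 0 := by omega
    rw [length_eq_zero_iff] at h4
    simpa [h4] using h
  · intro s hs v hvv hr ih l hl h
    have h1 : cs.simple s ∈ cs.leftInv (u' * l) := by
      rw [← h]
      refine (hu _ (mul_mem (simple_mem_par hs) hvv)).subset (hr.subset ?_)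
      rw [mem_leftInv_simple]
    obtain ⟨k, hk, e⟩ := conj_simple_mem hv hv' hs hl h1
    refine ih (cs.simple k * l) (mul_mem (simple_mem_par hk) hl) ?_
    rw [← mul_assoc, ← e, mul_assoc, ← h, mul_assoc, simple_mul_simple_mul]

/-- The intersection of a standard parabolic subgroup with a conjugate of another one. -/
theorem mem_par_of_conj {I J : Set B} {w : W} (hw : cs.LRed I w) (hw' : cs.RRed J w) :
    ∀ i ∈ cs.par I, w⁻¹ * i * w ∈ cs.par J →
      i ∈ cs.par {s | s ∈ I ∧ ∃ k ∈ J, cs.simple s * w = w * cs.simple k} := by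
  refine par_induction (fun _ => one_mem _) ?_
  intro s hs v hv hr ih h
  have h1 : cs.simple s ∈ cs.leftInv (w * (w⁻¹ * (cs.simple s * v) * w)) := by
    rw [show w * (w⁻¹ * (cs.simple s * v) * w) = (cs.simple s * v) * w by group]
    refine (hw _ (mul_mem (simple_mem_par hs) hv)).subset (hr.subset ?_)
    rw [mem_leftInv_simple]
  obtain ⟨k, hk, e⟩ := conj_simple_mem hw hw' hs h h1
  refine mul_mem (simple_mem_par ⟨hs, k, hk, e⟩) (ih ?_)
  have h2 : w⁻¹ * v * w = cs.simple k * (w⁻¹ * (cs.simple s * v) * w) := by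
    have e' : cs.simple k = w⁻¹ * cs.simple s * w := by rw [mul_assoc, e]; group
    rw [e']
    simp [mul_assoc]
  rw [h2]
  exact mul_mem (simple_mem_par hk) h

variable (cs)

/-- Conjugation by `w` carries the simple reflections of type `H` to simple reflections, and `w`
is reduced with respect to `W_H`. -/
def Par (H : Set B) (w : W) : Prop :=
  ∀ j ∈ H, cs.simple j ∉ cs.leftInv w ∧ ∃ k, cs.simple j * w = w * cs.simple k

/-- The set of types of `w⁻¹ s w`, for `s` simple of type in `H`. -/
def conjSet (H : Set B) (w : W) : Set B := {k | ∃ j ∈ H, cs.simple j * w = w * cs.simple k}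

variable {cs}

theorem mem_par_conjSet {H : Set B} {w : W} (h : ∀ j ∈ H, ∃ k, cs.simple j * w = w * cs.simple k)
    {x : W} : x ∈ cs.par (cs.conjSet H w) ↔ w * x * w⁻¹ ∈ cs.par H := by
  constructor
  · intro hx
    have : cs.par (cs.conjSet H w) ≤ (cs.par H).comap (MulAut.conj w).toMonoidHom := by
      rw [par, Subgroup.closure_le]
      rintro _ ⟨k, ⟨j, hj, e⟩, rfl⟩
      simp only [Subgroup.coe_comap, Set.mem_preimage, MulEquiv.coe_toMonoidHom, MulAut.conj_apply,
        ← e, mul_inv_cancel_right]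
      exact simple_mem_par hj
    exact this hx
  · intro hx
    have : cs.par H ≤ (cs.par (cs.conjSet H w)).comap (MulAut.conj w⁻¹).toMonoidHom := by
      conv_lhs => rw [par]
      rw [Subgroup.closure_le]
      rintro _ ⟨j, hj, rfl⟩
      obtain ⟨k, e⟩ := h j hj
      simp only [Subgroup.coe_comap, Set.mem_preimage, MulEquiv.coe_toMonoidHom, MulAut.conj_apply,
        inv_inv, mul_assoc, e, inv_mul_cancel_left]
      exact simple_mem_par ⟨j, hj, e⟩
    have h2 := this hx
    simpa [mul_assoc] using h2

theorem Par.mem_par_conjSet {H : Set B} {w : W} (h : cs.Par H w) {x : W} :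
    x ∈ cs.par (cs.conjSet H w) ↔ w * x * w⁻¹ ∈ cs.par H :=
  CoxeterSystem.mem_par_conjSet fun j hj => (h j hj).2

theorem Par.lRed {H : Set B} {w : W} (h : cs.Par H w) : cs.LRed H w :=
  lRed_of_simple fun j hj => (h j hj).1

theorem Par.rRed {H : Set B} {w : W} (h : cs.Par H w) : cs.RRed (cs.conjSet H w) w := by
  apply rRed_of_simple
  rintro k ⟨j, hj, e⟩
  rw [← e, length_simple_mul_of_not_mem (h j hj).1]

theorem par_of_conj_mem {H L : Set B} {w : W} (hl : cs.LRed H w) (hr : cs.RRed L w)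
    (h : ∀ j ∈ H, w⁻¹ * cs.simple j * w ∈ cs.par L) : cs.Par H w := by
  intro j hj
  refine ⟨hl.simple hj, ?_⟩
  obtain ⟨k, -, e⟩ := conj_simple_mem hl hr hj (h j hj) (by
    rw [show w * (w⁻¹ * cs.simple j * w) = cs.simple j * w by group]
    refine (hl _ (simple_mem_par hj)).subset ?_
    rw [mem_leftInv_simple])
  exact ⟨k, e⟩

theorem Par.of_mul {H : Set B} {w w' : W} (_h : cs.Par H w) (h' : cs.Par H (w * w'))
    (hr : cs.Red w w') : cs.Par (cs.conjSet H w) w' := by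
  rintro k ⟨j, hj, e⟩
  obtain ⟨h2, m, e'⟩ := h' j hj
  rw [hr.mem_leftInv_iff, mul_assoc, e, inv_mul_cancel_left, not_or] at h2
  refine ⟨h2.2, m, ?_⟩
  apply mul_left_cancel (a := w)
  rw [← mul_assoc, ← e, mul_assoc, e', mul_assoc]

theorem finite_length_le [Finite B] (n : ℕ) : {w : W | cs.length w ≤ n}.Finite := by
  refine ((List.finite_length_le B n).image cs.wordProd).subset ?_
  intro w hw
  obtain ⟨ω, hω, rfl⟩ := cs.exists_isReduced w
  refine ⟨ω, ?_, rfl⟩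
  have : cs.length (cs.wordProd ω) ≤ n := hw
  rwa [hω.eq] at this

variable (cs)

/-- `a` is the longest element of the parabolic subgroup `W_J`. -/
def IsLongest (J : Set B) (a : W) : Prop := a ∈ cs.par J ∧ ∀ v ∈ cs.par J, cs.Wle v a

variable {cs}

theorem exists_isLongest {J : Set B} {q : W} (h : ∀ j ∈ J, cs.simple j ∈ cs.leftInv q) :
    ∃ a, cs.IsLongest J a ∧ ∃ q', q = a * q' ∧ cs.LRed J q' := by
  obtain ⟨a, ha, q', hq', rfl⟩ := exists_eq_mul_lRed (cs := cs) J q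
  refine ⟨a, ⟨ha, ?_⟩, q', rfl, hq'⟩
  have hd : ∀ j ∈ J, cs.simple j ∈ cs.leftInv a := by
    intro j hj
    have h1 := h j hj
    rw [(hq' a ha).mem_leftInv_iff] at h1
    refine h1.resolve_right (lRed_iff_forall_not_mem.1 hq' _ ?_)
    exact mul_mem (mul_mem (inv_mem ha) (simple_mem_par hj)) ha
  refine par_induction (cs.one_wle a) ?_
  intro j hj v hv hr ih
  have h1 := hd j hj
  rw [show a = v * (v⁻¹ * a) by group, Red.mem_leftInv_iff ih] at h1
  have h2 := h1.resolve_left (red_simple_iff.1 hr)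
  apply cs.wle_of_length
  have h3 := h2.2
  have h4 : (cs.simple j * v)⁻¹ * a = v⁻¹ * cs.simple j * v * (v⁻¹ * a) := by
    simp [mul_assoc]
  rw [h4, ih.length_eq, hr, length_simple]
  omega

theorem IsLongest.unique {J : Set B} {a b : W} (ha : cs.IsLongest J a) (hb : cs.IsLongest J b) :
    a = b := (hb.2 a ha.1).antisymm (ha.2 b hb.1)

theorem IsLongest.mem_leftInv {J : Set B} {a : W} (ha : cs.IsLongest J a) {j : B} (hj : j ∈ J) :
    cs.simple j ∈ cs.leftInv a := by
  refine cs.wle_iff.1 (ha.2 _ (simple_mem_par hj)) ?_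
  rw [mem_leftInv_simple]

theorem IsLongest.inv_eq {J : Set B} {a : W} (ha : cs.IsLongest J a) : a⁻¹ = a := by
  have h := ha.2 _ (inv_mem ha.1)
  have h1 := h.length_eq
  rw [length_inv] at h1
  have h2 : cs.length (a⁻¹⁻¹ * a) = 0 := by omega
  rw [length_eq_zero_iff, inv_mul_eq_one] at h2
  exact h2

theorem IsLongest.conj_simple {J : Set B} {a : W} (ha : cs.IsLongest J a) {j : B} (hj : j ∈ J) :
    ∃ k ∈ J, cs.simple j * a = a * cs.simple k := by
  have h1 := (ha.2 _ (mul_mem (simple_mem_par hj) ha.1)).length_eq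
  have h2 := length_simple_mul_of_mem (ha.mem_leftInv hj)
  have h3 : (cs.simple j * a)⁻¹ * a = a⁻¹ * cs.simple j * a := by simp
  rw [h3] at h1
  obtain ⟨k, hk, e⟩ := mem_simple_image_of_length_one (J := J) (v := a⁻¹ * cs.simple j * a)
    (mul_mem (mul_mem (inv_mem ha.1) (simple_mem_par hj)) ha.1) (by omega)
  exact ⟨k, hk, by rw [← e]; group⟩

theorem IsLongest.finite [Finite B] {J : Set B} {a : W} (ha : cs.IsLongest J a) :
    (cs.par J : Set W).Finite := by
  refine (finite_length_le (cs := cs) (cs.length a)).subset fun v hv => ?_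
  have := (ha.2 v hv).length_eq
  show cs.length v ≤ cs.length a
  omega

theorem exists_isLongest_of_finite {J : Set B} (hJ : (cs.par J : Set W).Finite) :
    ∃ a, cs.IsLongest J a := by
  obtain ⟨a, ha, hmax⟩ := hJ.exists_maximalFor cs.length _ ⟨1, one_mem _⟩
  obtain ⟨b, hb, -⟩ := exists_isLongest (cs := cs) (J := J) (q := a) (by
    intro j hj
    by_contra h
    have h1 := length_simple_mul_of_not_mem h
    have h2 := hmax (mul_mem (simple_mem_par hj) ha) (by omega)
    omega)
  exact ⟨b, hb⟩

theorem exists_simple_wle {u x : W} (h : cs.Wle u x) (hne : u ≠ x) :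
    ∃ i, cs.Red u (cs.simple i) ∧ cs.Wle (u * cs.simple i) x := by
  have h1 : u⁻¹ * x ≠ 1 := fun h2 => hne (inv_mul_eq_one.1 h2)
  obtain ⟨i, hi⟩ := cs.exists_leftDescent_of_ne_one h1
  have h2 : cs.Wle (cs.simple i) (u⁻¹ * x) := by
    apply cs.wle_of_length
    rw [inv_simple, length_simple]
    have := cs.isLeftDescent_iff.1 hi
    omega
  have h3 : cs.Red u (cs.simple i * ((cs.simple i)⁻¹ * (u⁻¹ * x))) := by
    rw [mul_inv_cancel_left]; exact h
  obtain ⟨h4, h5⟩ := Red.assoc_left h2 h3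
  refine ⟨i, h4, ?_⟩
  have := h5.wle
  rwa [show u * cs.simple i * ((cs.simple i)⁻¹ * (u⁻¹ * x)) = x by group] at this

/-- The weak order is a meet-semilattice. -/
theorem exists_meet (w w' : W) : ∃ m, cs.Wle m w ∧ cs.Wle m w' ∧
    ∀ x, cs.Wle x w → cs.Wle x w' → cs.Wle x m := by
  have key : ∀ n u, cs.Wle u w → cs.Wle u w' → cs.length w ≤ cs.length u + n →
      ∃ m, cs.Wle m w ∧ cs.Wle m w' ∧ cs.Wle u m ∧
        ∀ x, cs.Wle x w → cs.Wle x w' → cs.Wle u x → cs.Wle x m := by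
    intro n
    induction n with
    | zero =>
      intro u hu hu' hl
      refine ⟨u, hu, hu', cs.wle_refl u, fun x hx _ hux => ?_⟩
      have h1 := hx.length_eq
      have h2 := hux.length_eq
      have h3 : cs.length (u⁻¹ * x) = 0 := by omega
      rw [length_eq_zero_iff, inv_mul_eq_one] at h3
      rw [h3]; exact cs.wle_refl x
    | succ n ih =>
      intro u hu hu' hl
      by_cases hex : ∃ i, cs.Red u (cs.simple i) ∧ cs.Wle (u * cs.simple i) w ∧
          cs.Wle (u * cs.simple i) w'
      · obtain ⟨i, hi, hiw, hiw'⟩ := hex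
        obtain ⟨m, hm, hm', him, hmax⟩ := ih _ hiw hiw' (by rw [hi, length_simple]; omega)
        refine ⟨m, hm, hm', hi.wle.trans him, fun x hx hx' hux => ?_⟩
        by_cases hne : u = x
        · rw [← hne]; exact hi.wle.trans him
        obtain ⟨j, hj, hjx⟩ := exists_simple_wle hux hne
        have hjw := hjx.trans hx
        have hjw' := hjx.trans hx'
        obtain ⟨m', hmw, hmw', hjm, hmax'⟩ := ih _ hjw hjw' (by rw [hj, length_simple]; omega)
        refine (hmax' x hx hx' hjx).trans (hmax m' hmw hmw' ?_)
        have hdesc : ∀ z, cs.Wle u z → cs.Wle (u * cs.simple i) z → cs.Wle (u * cs.simple j) z →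
            ∀ k ∈ ({i, j} : Set B), cs.simple k ∈ cs.leftInv (u⁻¹ * z) := by
          intro z hz hiz hjz k hk
          have hk' : cs.Red u (cs.simple k) ∧ cs.Wle (u * cs.simple k) z := by
            rcases hk with rfl | rfl
            · exact ⟨hi, hiz⟩
            · exact ⟨hj, hjz⟩
          rw [show z = u * (u⁻¹ * z) by group, wle_mul_left_iff hk'.1 hz] at hk'
          refine cs.wle_iff.1 hk'.2 ?_
          rw [mem_leftInv_simple]
        have haux : ∀ z, cs.Wle u z → cs.Wle (u * cs.simple i) z → cs.Wle (u * cs.simple j) z →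
            ∃ a, cs.IsLongest {i, j} a ∧ cs.Red u a ∧ cs.Wle (u * a) z := by
          intro z hz hiz hjz
          obtain ⟨a, ha, q', hq, hl'⟩ := exists_isLongest (hdesc z hz hiz hjz)
          have h1 : cs.Red u (a * q') := by rw [← hq]; exact hz
          obtain ⟨h2, h3⟩ := Red.assoc_left (hl' a ha.1) h1
          refine ⟨a, ha, h2, ?_⟩
          have := h3.wle
          rwa [mul_assoc, ← hq, mul_inv_cancel_left] at this
        obtain ⟨a, ha, hua, haw⟩ := haux w hu hiw hjw
        obtain ⟨a', ha', -, haw'⟩ := haux w' hu' hiw' hjw'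
        rw [← ha.unique ha'] at haw'
        have hia : cs.Wle (u * cs.simple i) (u * a) :=
          (wle_mul_left_iff hi hua).2 (ha.2 _ (simple_mem_par (by simp)))
        have hja : cs.Wle (u * cs.simple j) (u * a) :=
          (wle_mul_left_iff hj hua).2 (ha.2 _ (simple_mem_par (by simp)))
        exact hia.trans (hmax' _ haw haw' hja)
      · refine ⟨u, hu, hu', cs.wle_refl u, fun x hx hx' hux => ?_⟩
        by_cases hne : u = x
        · rw [hne]; exact cs.wle_refl x
        · obtain ⟨i, hi, hix⟩ := exists_simple_wle hux hne
          exact absurd ⟨i, hi, hix.trans hx, hix.trans hx'⟩ hex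
  obtain ⟨m, h1, h2, -, h3⟩ := key (cs.length w) 1 (cs.one_wle w) (cs.one_wle w') (by omega)
  exact ⟨m, h1, h2, fun x hx hx' => h3 x hx hx' (cs.one_wle x)⟩

theorem Par.meet {H : Set B} {a a' b : W} (ha : cs.Par H a) (ha' : cs.Par H a') (hb : cs.Wle b a)
    (hb' : cs.Wle b a') (hmax : ∀ x, cs.Wle x a → cs.Wle x a' → cs.Wle x b) : cs.Par H b := by
  intro j hj
  have hjb : cs.simple j ∉ cs.leftInv b := fun h => (ha j hj).1 (cs.wle_iff.1 hb h)
  refine ⟨hjb, ?_⟩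
  obtain ⟨q, hq, hq', hqmax⟩ := exists_meet (cs := cs) (cs.simple j * a) (cs.simple j * a')
  have hup : ∀ a, cs.Par H a → cs.Wle b a → cs.Wle b (cs.simple j * a) := by
    intro a ha hb
    obtain ⟨h1, k, e⟩ := ha j hj
    refine hb.trans ?_
    rw [e]
    apply Red.wle
    rw [Red, ← e, length_simple_mul_of_not_mem h1, length_simple]
  have hr : ∀ {a}, cs.Par H a → cs.Red (cs.simple j) a := fun ha => red_simple_iff.2 (ha j hj).1
  have hrb : cs.Red (cs.simple j) b := red_simple_iff.2 hjb
  have hbq : cs.Wle b q := hqmax b (hup a ha hb) (hup a' ha' hb')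
  have hjq : cs.Wle (cs.simple j) q := hqmax _ (hr ha).wle (hr ha').wle
  have e : q = cs.simple j * ((cs.simple j)⁻¹ * q) := by group
  have hqb : cs.Wle q (cs.simple j * b) := by
    rw [e] at hq hq' ⊢
    rw [wle_mul_left_iff hjq hrb]
    exact hmax _ ((wle_mul_left_iff hjq (hr ha)).1 hq) ((wle_mul_left_iff hjq (hr ha')).1 hq')
  have h1 := hbq.trans hqb
  have h2 := h1.length_eq
  rw [hrb, length_simple] at h2
  obtain ⟨k, hk⟩ := cs.length_eq_one_iff.1 (show cs.length (b⁻¹ * (cs.simple j * b)) = 1 by omega)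
  exact ⟨k, by rw [← hk]; group⟩

/-- The set of common transporters of a family of parabolic subgroups based at `u i` has a least
element for the weak order. -/
theorem exists_least_transporter {ι : Type*} (u : ι → W) (I : ι → Set B)
    (hne : ∃ v, ∀ i, cs.Wle (u i) v ∧ cs.Par (I i) ((u i)⁻¹ * v)) :
    ∃ v, (∀ i, cs.Wle (u i) v ∧ cs.Par (I i) ((u i)⁻¹ * v)) ∧
      ∀ v', (∀ i, cs.Wle (u i) v' ∧ cs.Par (I i) ((u i)⁻¹ * v')) → cs.Wle v v' := by
  classical
  have hne' : ∃ n, ∃ v, (∀ i, cs.Wle (u i) v ∧ cs.Par (I i) ((u i)⁻¹ * v)) ∧ cs.length v = n := by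
    obtain ⟨v, hv⟩ := hne
    exact ⟨_, v, hv, rfl⟩
  obtain ⟨v, hv, hl⟩ := Nat.find_spec hne'
  refine ⟨v, hv, fun v' hv' => ?_⟩
  obtain ⟨m, hm, hm', hmax⟩ := exists_meet (cs := cs) v v'
  have hmem : ∀ i, cs.Wle (u i) m ∧ cs.Par (I i) ((u i)⁻¹ * m) := by
    intro i
    have hum : cs.Wle (u i) m := hmax _ (hv i).1 (hv' i).1
    have tr : ∀ v, cs.Wle (u i) v → cs.Wle m v → cs.Wle ((u i)⁻¹ * m) ((u i)⁻¹ * v) := by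
      intro v h h'
      rw [← wle_mul_left_iff hum h]
      simpa using h'
    refine ⟨hum, (hv i).2.meet (hv' i).2 (tr v (hv i).1 hm) (tr v' (hv' i).1 hm') ?_⟩
    intro x hx hx'
    have hux : cs.Red (u i) x := by
      have h1 : cs.Red (u i) (x * (x⁻¹ * ((u i)⁻¹ * v))) := by
        rw [mul_inv_cancel_left]; exact (hv i).1
      exact (Red.assoc_left hx h1).1
    rw [← wle_mul_left_iff hux hum, mul_inv_cancel_left]
    apply hmax
    · have := (wle_mul_left_iff hux (hv i).1).2 hx
      simpa using this
    · have := (wle_mul_left_iff hux (hv' i).1).2 hx'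
      simpa using this
  have hlm : cs.length v ≤ cs.length m := by
    rw [hl]
    exact Nat.find_min' hne' ⟨m, hmem, rfl⟩
  have h1 := hm.length_eq
  have h2 : cs.length (m⁻¹ * v) = 0 := by omega
  rw [length_eq_zero_iff, inv_mul_eq_one] at h2
  rw [← h2]
  exact hm'

end CoxeterSystem

namespace Bldg

open CoxeterSystem

variable {cs : CoxeterSystem M W} (X : Bldg cs)

@[simp] theorem delta_self (C : X.Chamber) : X.delta C C = 1 := (X.delta_eq_one_iff C C).2 rfl

theorem delta_simple_symm {C D : X.Chamber} {i : B} (h : X.delta C D = cs.simple i) :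
    X.delta D C = cs.simple i := by
  rcases X.delta_mem_pair D C D i h with h1 | h1
  · rw [delta_self] at h1
    simpa using (eq_inv_of_mul_eq_one_left h1.symm)
  · rw [delta_self, eq_comm, delta_eq_one_iff] at h1
    rw [h1, delta_self] at h
    have := congrArg cs.length h
    simp at this

/-- Removal of the last letter of a minimal gallery. -/
theorem exists_last (C : X.Chamber) {D : X.Chamber} (h : C ≠ D) :
    ∃ E i, X.delta E D = cs.simple i ∧ X.delta C D = X.delta C E * cs.simple i ∧
      cs.Red (X.delta C E) (cs.simple i) := by
  have h1 : X.delta C D ≠ 1 := fun h' => h ((X.delta_eq_one_iff C D).1 h')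
  obtain ⟨i, hi⟩ := cs.exists_rightDescent_of_ne_one h1
  obtain ⟨E, hE, hE'⟩ := X.exists_delta C D i
  have := cs.isRightDescent_iff.1 hi
  refine ⟨E, i, X.delta_simple_symm hE, by rw [hE']; simp, ?_⟩
  rw [Red, hE', length_simple, simple_mul_simple_cancel_right]
  exact this.symm

variable {X}

theorem delta_eq_mul_of_red : ∀ {C D E : X.Chamber}, cs.Red (X.delta C D) (X.delta D E) →
    X.delta C E = X.delta C D * X.delta D E := by
  have : ∀ n, ∀ C D E : X.Chamber, cs.length (X.delta D E) = n →
      cs.Red (X.delta C D) (X.delta D E) → X.delta C E = X.delta C D * X.delta D E := by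
    intro n
    induction n with
    | zero =>
      intro C D E h _
      rw [length_eq_zero_iff] at h
      rw [h, mul_one, (X.delta_eq_one_iff D E).1 h]
    | succ n ih =>
      intro C D E h hr
      obtain ⟨F, i, h1, h2, h3⟩ := X.exists_last D (D := E) (by rintro rfl; simp at h)
      rw [h2] at hr ⊢
      obtain ⟨h4, h5⟩ := Red.assoc_left h3 hr
      rw [h2, h3, length_simple] at h
      have h6 := ih C D F (by omega) h4
      rw [X.delta_eq_of_length C F E i h1, h6, mul_assoc]
      rw [h6, h5, length_simple]
  exact fun {C D E} h => this _ C D E rfl h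

theorem delta_symm : ∀ C D : X.Chamber, X.delta D C = (X.delta C D)⁻¹ := by
  have : ∀ n, ∀ C D : X.Chamber, cs.length (X.delta C D) = n →
      X.delta D C = (X.delta C D)⁻¹ := by
    intro n
    induction n with
    | zero =>
      intro C D h
      rw [length_eq_zero_iff] at h
      rw [h, (X.delta_eq_one_iff C D).1 h, delta_self, inv_one]
    | succ n ih =>
      intro C D h
      obtain ⟨F, i, h1, h2, h3⟩ := X.exists_last C (D := D) (by rintro rfl; simp at h)
      rw [h2, h3, length_simple] at h
      have h4 := ih C F (by omega)
      rw [h2, mul_inv_rev, ← h4, inv_simple, ← X.delta_simple_symm h1]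
      apply delta_eq_mul_of_red
      rw [X.delta_simple_symm h1, h4]
      simpa using h3.inv
  exact fun C D => this _ C D rfl

theorem gdist_symm (C D : X.Chamber) : X.gdist C D = X.gdist D C := by
  rw [gdist, gdist, delta_symm, length_inv]

@[simp] theorem gdist_self (C : X.Chamber) : X.gdist C C = 0 := by simp [gdist]

theorem gdist_eq_zero {C D : X.Chamber} : X.gdist C D = 0 ↔ C = D := by
  rw [gdist, length_eq_zero_iff, delta_eq_one_iff]

/-- `D` lies on a minimal gallery from `C` to `E`. -/
def Btw (C D E : X.Chamber) : Prop := X.gdist C E = X.gdist C D + X.gdist D E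

theorem gdist_adj {C D E : X.Chamber} {i : B} (h : X.delta D E = cs.simple i) :
    X.gdist C E ≤ X.gdist C D + 1 := by
  rw [gdist, gdist]
  have := cs.length_mul_simple (X.delta C D) i
  rcases X.delta_mem_pair C D E i h with h | h <;> rw [h] <;> omega

theorem gdist_triangle_and : ∀ n, ∀ C D E : X.Chamber, X.gdist D E = n →
    X.gdist C E ≤ X.gdist C D + X.gdist D E ∧
      (Btw C D E → X.delta C E = X.delta C D * X.delta D E) := by
  intro n
  induction n with
  | zero =>
    intro C D E h
    rw [gdist_eq_zero] at h
    subst h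
    simp
  | succ n ih =>
    intro C D E h
    obtain ⟨F, i, h1, h2, h3⟩ := X.exists_last D (D := E) (by rintro rfl; simp at h)
    have h4 : X.gdist D E = X.gdist D F + 1 := by rw [gdist, h2, h3, length_simple]; rfl
    obtain ⟨h5, h6⟩ := ih C D F (by omega)
    have h7 := gdist_adj (C := C) h1
    refine ⟨by omega, fun h8 => ?_⟩
    rw [Btw] at h6 h8
    have h9 := h6 (by omega)
    rw [h2, ← mul_assoc, ← h9]
    refine (X.delta_mem_pair C F E i h1).resolve_right fun h10 => ?_
    have : X.gdist C E = X.gdist C F := by rw [gdist, gdist, h10]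
    omega

theorem gdist_triangle (C D E : X.Chamber) : X.gdist C E ≤ X.gdist C D + X.gdist D E :=
  (gdist_triangle_and _ C D E rfl).1

theorem Btw.delta_eq {C D E : X.Chamber} (h : Btw C D E) :
    X.delta C E = X.delta C D * X.delta D E :=
  (gdist_triangle_and _ C D E rfl).2 h

theorem btw_iff_red {C D E : X.Chamber} : Btw C D E ↔ cs.Red (X.delta C D) (X.delta D E) := by
  constructor
  · intro h
    rw [Red, ← h.delta_eq]
    exact h
  · intro h
    rw [Btw, gdist, delta_eq_mul_of_red h, h]
    rfl

theorem Btw.red {C D E : X.Chamber} (h : Btw C D E) : cs.Red (X.delta C D) (X.delta D E) :=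
  btw_iff_red.1 h

theorem Btw.delta_right {C D E : X.Chamber} (h : Btw C D E) :
    X.delta D E = (X.delta C D)⁻¹ * X.delta C E := by rw [h.delta_eq]; group

theorem Btw.wle {C D E : X.Chamber} (h : Btw C D E) : cs.Wle (X.delta C D) (X.delta C E) := by
  rw [h.delta_eq]; exact h.red.wle

theorem Btw.symm {C D E : X.Chamber} (h : Btw C D E) : Btw E D C := by
  rw [Btw] at *
  rw [gdist_symm E C, gdist_symm E D, gdist_symm D C]; omega

theorem Btw.trans_left {C D E F : X.Chamber} (h : Btw C D F) (h' : Btw C E D) :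
    Btw C E F ∧ Btw E D F := by
  unfold Btw at *
  have := gdist_triangle C E F
  have := gdist_triangle E D F
  omega

theorem Btw.trans_right {C D E F : X.Chamber} (h : Btw C D F) (h' : Btw D E F) :
    Btw C E F ∧ Btw C D E := by
  unfold Btw at *
  have := gdist_triangle C E F
  have := gdist_triangle C D E
  omega

theorem btw_left (C D : X.Chamber) : Btw C C D := by simp [Btw]

theorem exists_btw_mul : ∀ {C E : X.Chamber} {u v : W}, cs.Red u v → X.delta C E = u * v →
    ∃ D, X.delta C D = u ∧ X.delta D E = v := by
  have : ∀ n, ∀ {C E : X.Chamber} {u v : W}, cs.length v = n → cs.Red u v → X.delta C E = u * v →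
      ∃ D, X.delta C D = u ∧ X.delta D E = v := by
    intro n
    induction n with
    | zero =>
      intro C E u v hn _ h
      rw [length_eq_zero_iff] at hn
      exact ⟨E, by rw [h, hn, mul_one], by rw [hn, delta_self]⟩
    | succ n ih =>
      intro C E u v hn hr h
      obtain ⟨i, hi⟩ := cs.exists_rightDescent_of_ne_one (w := v) (by rintro rfl; simp at hn)
      obtain ⟨F, hF, hF'⟩ := X.exists_delta C E i
      have h1 := cs.isRightDescent_iff.1 hi
      have h2 : cs.Red (v * cs.simple i) (cs.simple i) := by
        rw [Red, simple_mul_simple_cancel_right, length_simple]; omega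
      have h3 := (Red.assoc_left (u := u) h2 (by rwa [simple_mul_simple_cancel_right])).1
      obtain ⟨D, hD, hD'⟩ := ih (C := C) (E := F) (by omega) h3 (by rw [hF', h, mul_assoc])
      refine ⟨D, hD, ?_⟩
      have h4 := X.delta_simple_symm hF
      rw [delta_eq_mul_of_red (D := F) (by rwa [hD', h4]), hD', h4, simple_mul_simple_cancel_right]
  exact fun {C E u v} hr h => this _ rfl hr h

/-- The chamber at a given position on a minimal gallery. -/
theorem exists_btw {C E : X.Chamber} {u : W} (h : cs.Wle u (X.delta C E)) :
    ∃ D, X.delta C D = u ∧ Btw C D E := by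
  obtain ⟨D, hD, hD'⟩ := exists_btw_mul (X := X) (C := C) (E := E) h (by group)
  exact ⟨D, hD, by rw [btw_iff_red, hD, hD']; exact h⟩

theorem exists_delta_eq (C : X.Chamber) (w : W) : ∃ D, X.delta C D = w := by
  induction w using cs.simple_induction_right with
  | one => exact ⟨C, by simp⟩
  | mul_simple_right w i ih =>
    obtain ⟨D, hD⟩ := ih
    obtain ⟨E, -, hE⟩ := X.exists_delta C D i
    exact ⟨E, by rw [hE, hD]⟩

theorem Btw.unique : ∀ {C D D' E : X.Chamber}, Btw C D E → Btw C D' E →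
    X.delta C D = X.delta C D' → D = D' := by
  have : ∀ n, ∀ {C D D' E : X.Chamber}, X.gdist D E = n → Btw C D E → Btw C D' E →
    X.delta C D = X.delta C D' → D = D' := by
    intro n
    induction n with
    | zero =>
      intro C D D' E hn h h' he
      rw [gdist_eq_zero] at hn
      subst hn
      rw [Btw, gdist, gdist, he] at h'
      exact (gdist_eq_zero.1 (by omega : X.gdist D' D = 0)).symm
    | succ n ih =>
      intro C D D' E hn h h' he
      obtain ⟨F, i, h1, h2, h3⟩ := X.exists_last D (D := E) (by rintro rfl; simp at hn)
      have hDF : Btw D F E := by rw [btw_iff_red, h1]; exact h3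
      have h4 : X.delta D' E = X.delta D F * cs.simple i := by
        rw [← h2, h'.delta_right, h.delta_right, he]
      obtain ⟨F', hF, hF'⟩ := exists_btw_mul h3 h4
      have hDF' : Btw D' F' E := by rw [btw_iff_red, hF, hF']; exact h3
      have h5 := h.trans_right hDF
      have h6 := h'.trans_right hDF'
      have hC : X.delta C F = X.delta C F' := by
        rw [h5.2.delta_eq, h6.2.delta_eq, he, hF]
      have hFF : F = F' := by
        rcases X.delta_mem_pair F E F' i (X.delta_simple_symm hF') with h7 | h7
        · rw [h1] at h7
          simpa [delta_eq_one_iff] using h7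
        · rw [h1] at h7
          have h8 := X.delta_eq_of_length C F F' i h7 (by
            have := h5.1.red
            rw [h1, Red, length_simple] at this
            exact this)
          rw [← hC] at h8
          have h9 := congrArg cs.length h8
          exact absurd h9.symm (cs.length_mul_simple_ne _ _)
      subst hFF
      refine ih ?_ h5.2 h6.2 he
      rw [Btw] at hDF
      have : X.gdist F E = 1 := by rw [gdist, h1, length_simple]
      omega
  exact fun {C D D' E} h => this _ rfl h

/-- Any two chambers on minimal galleries between the same extremities lie in a common
apartment. -/
theorem Btw.delta_eq_of_btw : ∀ {C D D' E : X.Chamber}, Btw C D E → Btw C D' E →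
    X.delta D D' = (X.delta C D)⁻¹ * X.delta C D' := by
  have : ∀ n, ∀ {C D D' E : X.Chamber}, cs.length ((X.delta C D)⁻¹ * X.delta C D') = n →
    Btw C D E → Btw C D' E → X.delta D D' = (X.delta C D)⁻¹ * X.delta C D' := by
    intro n
    induction n with
    | zero =>
      intro C D D' E hn h h'
      rw [length_eq_zero_iff] at hn
      rw [hn, delta_eq_one_iff]
      exact h.unique h' (inv_mul_eq_one.1 hn)
    | succ n ih =>
      intro C D D' E hn h h'
      obtain ⟨i, hi⟩ := cs.exists_leftDescent_of_ne_one
        (w := (X.delta C D)⁻¹ * X.delta C D') (by intro h; rw [h] at hn; simp at hn)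
      have hi := cs.isLeftDescent_iff.1 hi
      have e1 : (X.delta C D * cs.simple i)⁻¹ * X.delta C D' =
        cs.simple i * ((X.delta C D)⁻¹ * X.delta C D') := by simp [mul_assoc]
      have hr : cs.Red (cs.simple i) (cs.simple i * ((X.delta C D)⁻¹ * X.delta C D')) := by
        rw [Red, length_simple, simple_mul_simple_mul]; omega
      have hw : cs.Wle (X.delta C D * cs.simple i) (X.delta C E) := by
        refine wle_of_between h.wle h'.wle ?_
        rwa [e1, inv_mul_cancel_left]
      obtain ⟨F, hF, hFb⟩ := exists_btw hw
      have h1 := ih (by rw [hF, e1]; omega) hFb h'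
      have h2 : X.delta D F = cs.simple i := by
        rcases cs.length_mul_simple (X.delta C D) i with hl | hl
        · obtain ⟨G, hG, hG'⟩ := exists_btw_mul (X := X) (C := C) (E := F) (u := X.delta C D)
            (v := cs.simple i) (by rw [Red, hl, length_simple]) hF
          have hGb : Btw C G F := by
            rw [btw_iff_red, hG, hG', Red, hl, length_simple]
          rw [h.unique (hFb.trans_left hGb).1 hG.symm, hG']
        · have hr' : cs.Red (X.delta C D * cs.simple i) (cs.simple i) := by
            rw [Red, simple_mul_simple_cancel_right, length_simple, hl]
          obtain ⟨G, hG, hG'⟩ := exists_btw_mul (X := X) (C := C) (E := D)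
            (u := X.delta C D * cs.simple i) (v := cs.simple i) hr' (by simp)
          have hGb : Btw C G D := by rwa [btw_iff_red, hG, hG']
          rw [hFb.unique (h.trans_left hGb).1 (hF.trans hG.symm)]
          exact X.delta_simple_symm hG'
      rw [hF, e1] at h1
      rw [delta_eq_mul_of_red (D := F) (by rwa [h1, h2]), h1, h2, simple_mul_simple_mul]
  exact fun {C D D' E} => this _ rfl

/-- Intervals are convex. -/
theorem Btw.convex {C D D' E F : X.Chamber} (h : Btw C D E) (h' : Btw C D' E)
    (hF : Btw D F D') : Btw C F E := by
  have h1 := h.delta_eq_of_btw h'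
  have hred := hF.red
  have hw : cs.Wle (X.delta C D * X.delta D F) (X.delta C E) := by
    refine wle_of_between h.wle h'.wle ?_
    rw [inv_mul_cancel_left, mul_inv_rev, mul_assoc, ← h1, ← hF.delta_right]
    exact hred
  obtain ⟨G, hG, hGb⟩ := exists_btw hw
  have h2 := h.delta_eq_of_btw hGb
  have h3 := hGb.delta_eq_of_btw h'
  rw [hG, inv_mul_cancel_left] at h2
  rw [hG, mul_inv_rev, mul_assoc, ← h1, ← hF.delta_right] at h3
  have hDG : Btw D G D' := by rwa [btw_iff_red, h2, h3]
  rwa [hF.unique hDG h2.symm]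

theorem exists_delta_mul {J : Set B} (C : X.Chamber) {D E : X.Chamber}
    (h : X.delta D E ∈ cs.par J) : ∃ x ∈ cs.par J, X.delta C E = X.delta C D * x := by
  have key : ∀ v ∈ cs.par J, ∀ E, X.delta D E = v⁻¹ →
      ∃ x ∈ cs.par J, X.delta C E = X.delta C D * x := by
    refine par_induction ?_ ?_
    · intro E h
      rw [inv_one, delta_eq_one_iff] at h
      exact ⟨1, one_mem _, by rw [h, mul_one]⟩
    · intro j hj v _ _ ih E h
      obtain ⟨F, hF, hF'⟩ := X.exists_delta D E j
      rw [h, mul_inv_rev, inv_simple, simple_mul_simple_cancel_right] at hF'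
      obtain ⟨x, hx, e⟩ := ih F hF'
      rcases X.delta_mem_pair C F E j (X.delta_simple_symm hF) with h1 | h1
      · exact ⟨x * cs.simple j, mul_mem hx (simple_mem_par hj), by rw [h1, e, mul_assoc]⟩
      · exact ⟨x, hx, by rw [h1, e]⟩
  exact key _ (inv_mem h) E (by simp)

theorem mem_residue {J : Set B} {C D : X.Chamber} :
    D ∈ X.residue J C ↔ X.delta C D ∈ cs.par J := Iff.rfl

theorem mem_residue_self (J : Set B) (C : X.Chamber) : C ∈ X.residue J C := by
  rw [mem_residue, delta_self]; exact one_mem _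

theorem delta_mem_par_trans {J : Set B} {C D E : X.Chamber} (h : X.delta C D ∈ cs.par J)
    (h' : X.delta D E ∈ cs.par J) : X.delta C E ∈ cs.par J := by
  obtain ⟨x, hx, e⟩ := exists_delta_mul C h'
  rw [e]
  exact mul_mem h hx

theorem delta_mem_par_symm {J : Set B} {C D : X.Chamber} (h : X.delta C D ∈ cs.par J) :
    X.delta D C ∈ cs.par J := by
  rw [delta_symm]; exact inv_mem h

theorem residue_eq_of_mem {J : Set B} {C D : X.Chamber} (h : D ∈ X.residue J C) :
    X.residue J C = X.residue J D := by
  ext E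
  exact ⟨fun h' => delta_mem_par_trans (delta_mem_par_symm h) h',
    fun h' => delta_mem_par_trans h h'⟩

theorem residue_mono {I J : Set B} (h : cs.par I ≤ cs.par J) (C : X.Chamber) :
    X.residue I C ⊆ X.residue J C := fun _ hD => h hD

variable (X)

/-- `R` is a residue, not necessarily spherical, of type `J`. -/
def IsRes (J : Set B) (R : Set X.Chamber) : Prop := ∃ C, R = X.residue J C

variable {X}

theorem IsRes.eq_residue {J : Set B} {R : Set X.Chamber} (hR : X.IsRes J R) {C : X.Chamber}
    (hC : C ∈ R) : R = X.residue J C := by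
  obtain ⟨D, rfl⟩ := hR
  exact residue_eq_of_mem hC

theorem isRes_residue (J : Set B) (C : X.Chamber) : X.IsRes J (X.residue J C) := ⟨C, rfl⟩

theorem IsRes.nonempty {J : Set B} {R : Set X.Chamber} (hR : X.IsRes J R) : R.Nonempty := by
  obtain ⟨C, rfl⟩ := hR
  exact ⟨C, mem_residue_self J C⟩

theorem IsRes.delta_mem {J : Set B} {R : Set X.Chamber} (hR : X.IsRes J R) {C D : X.Chamber}
    (hC : C ∈ R) (hD : D ∈ R) : X.delta C D ∈ cs.par J := by
  rw [hR.eq_residue hC] at hD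
  exact hD

theorem IsRes.mem_of_delta {J : Set B} {R : Set X.Chamber} (hR : X.IsRes J R) {C D : X.Chamber}
    (hC : C ∈ R) (hD : X.delta C D ∈ cs.par J) : D ∈ R := by
  rw [hR.eq_residue hC]; exact hD

theorem gate_eq {R : Set X.Chamber} {C D : X.Chamber} (hD : D ∈ R)
    (h : ∀ E ∈ R, Btw C D E) : X.gate R C = D := by
  have hs := Classical.epsilon_spec (p := fun D => D ∈ R ∧ ∀ E ∈ R, Btw C D E) ⟨D, hD, h⟩
  have h1 : X.gate R C ∈ R ∧ ∀ E ∈ R, Btw C (X.gate R C) E := hs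
  have h2 := h1.2 D hD
  have h3 := h _ h1.1
  rw [Btw] at h2 h3
  exact gdist_eq_zero.1 (by omega)

theorem gate_eq_of_rRed {J : Set B} {R : Set X.Chamber} (hR : X.IsRes J R) {C D : X.Chamber}
    (hD : D ∈ R) (h : cs.RRed J (X.delta C D)) : X.gate R C = D :=
  gate_eq hD fun _ hE => btw_iff_red.2 (h _ (hR.delta_mem hD hE))

theorem IsRes.gate_spec {J : Set B} {R : Set X.Chamber} (hR : X.IsRes J R) (C : X.Chamber) :
    X.gate R C ∈ R ∧ (∀ E ∈ R, Btw C (X.gate R C) E) ∧ cs.RRed J (X.delta C (X.gate R C)) := by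
  classical
  have hne : ∃ n, ∃ D ∈ R, X.gdist C D = n := by
    obtain ⟨D, hD⟩ := hR.nonempty
    exact ⟨_, D, hD, rfl⟩
  obtain ⟨D, hD, hl⟩ := Nat.find_spec hne
  have hr : cs.RRed J (X.delta C D) := by
    apply rRed_of_simple
    intro j hj
    obtain ⟨E, hE, hE'⟩ := X.exists_delta C D j
    have h1 := Nat.find_min' hne ⟨E, hR.mem_of_delta hD (by rw [hE]; exact simple_mem_par hj), rfl⟩
    rw [← hl, gdist, gdist, hE'] at h1
    have := cs.length_mul_simple (X.delta C D) j
    omega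
  rw [gate_eq_of_rRed hR hD hr]
  exact ⟨hD, fun E hE => btw_iff_red.2 (hr _ (hR.delta_mem hD hE)), hr⟩

theorem IsRes.gate_mem {J : Set B} {R : Set X.Chamber} (hR : X.IsRes J R) (C : X.Chamber) :
    X.gate R C ∈ R := (hR.gate_spec C).1

theorem IsRes.btw_gate {J : Set B} {R : Set X.Chamber} (hR : X.IsRes J R) (C : X.Chamber)
    {E : X.Chamber} (hE : E ∈ R) : Btw C (X.gate R C) E := (hR.gate_spec C).2.1 E hE

theorem IsRes.gate_of_mem {J : Set B} {R : Set X.Chamber} (_hR : X.IsRes J R) {C : X.Chamber}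
    (hC : C ∈ R) : X.gate R C = C := gate_eq hC fun E _ => btw_left C E

/-- A chamber on a minimal gallery from `C` to its gate has the same gate. -/
theorem IsRes.gate_eq_of_btw {J : Set B} {R : Set X.Chamber} (hR : X.IsRes J R)
    {C D : X.Chamber} (h : Btw C D (X.gate R C)) : X.gate R D = X.gate R C :=
  gate_eq (hR.gate_mem C) fun _ hE => ((hR.btw_gate C hE).trans_left h).2

variable (X)

/-- `C ∈ R` and `D ∈ T` are the gates of each other. -/
def Mutual (R T : Set X.Chamber) (C D : X.Chamber) : Prop :=
  C ∈ R ∧ D ∈ T ∧ X.gate R D = C ∧ X.gate T C = D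

variable {X}

theorem Mutual.symm {R T : Set X.Chamber} {C D : X.Chamber} (h : X.Mutual R T C D) :
    X.Mutual T R D C := ⟨h.2.1, h.1, h.2.2.2, h.2.2.1⟩

theorem Mutual.lRed {J : Set B} {R T : Set X.Chamber} {C D : X.Chamber}
    (h : X.Mutual R T C D) (hR : X.IsRes J R) : cs.LRed J (X.delta C D) := by
  rw [lRed_iff, ← delta_symm, ← h.2.2.1]
  exact (hR.gate_spec D).2.2

theorem Mutual.rRed {J : Set B} {R T : Set X.Chamber} {C D : X.Chamber}
    (h : X.Mutual R T C D) (hT : X.IsRes J T) : cs.RRed J (X.delta C D) := by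
  rw [← h.2.2.2]
  exact (hT.gate_spec C).2.2

theorem mutual_gate {I J : Set B} {R T : Set X.Chamber} (hR : X.IsRes I R) (hT : X.IsRes J T)
    {C : X.Chamber} (hC : C ∈ R) :
    X.Mutual R T (X.gate R (X.gate T C)) (X.gate T C) := by
  refine ⟨hR.gate_mem _, hT.gate_mem _, rfl, ?_⟩
  exact hT.gate_eq_of_btw (hR.btw_gate (X.gate T C) hC).symm

theorem exists_mutual {I J : Set B} {R T : Set X.Chamber} (hR : X.IsRes I R) (hT : X.IsRes J T) :
    ∃ C D, X.Mutual R T C D := by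
  obtain ⟨C, hC⟩ := hR.nonempty
  exact ⟨_, _, mutual_gate hR hT hC⟩

theorem Mutual.delta_eq {I J : Set B} {R T : Set X.Chamber} (hR : X.IsRes I R)
    (hT : X.IsRes J T) {C D C' D' : X.Chamber} (h : X.Mutual R T C D) (h' : X.Mutual R T C' D') :
    X.delta C' D' = X.delta C D ∧
      X.delta C C' * X.delta C D = X.delta C D * X.delta D D' := by
  have h1 := (hR.btw_gate D' h.1).symm
  rw [h'.2.2.1] at h1
  have h2 := hT.btw_gate C h'.2.1
  rw [h.2.2.2] at h2
  have h3 : X.delta C C' * X.delta C' D' = X.delta C D * X.delta D D' := by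
    rw [← h1.delta_eq, ← h2.delta_eq]
  have h4 := eq_of_double_coset (h'.lRed hR) (h'.rRed hT) (h.lRed hR) (h.rRed hT) _
    (hR.delta_mem h.1 h'.1) _ (hT.delta_mem h.2.1 h'.2.1) h3
  exact ⟨h4, by rw [h4] at h3; exact h3⟩

/-- The projection of a residue onto another one is a residue. -/
theorem Mutual.projSet_eq {I J : Set B} {R T : Set X.Chamber} (hR : X.IsRes I R)
    (hT : X.IsRes J T) {C D : X.Chamber} (h : X.Mutual R T C D) :
    X.projSet R T = X.residue
      {s | s ∈ I ∧ ∃ k ∈ J, cs.simple s * X.delta C D = X.delta C D * cs.simple k} C := by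
  ext E
  constructor
  · rintro ⟨F, hF, rfl⟩
    have h1 := (mutual_gate hT hR hF).symm
    obtain ⟨-, h3⟩ := h.delta_eq hR hT h1
    refine mem_par_of_conj (h.lRed hR) (h.rRed hT) _ (hR.delta_mem h.1 h1.1) ?_
    rw [mul_assoc, h3, inv_mul_cancel_left]
    exact hT.delta_mem h.2.1 h1.2.1
  · intro hE
    set L : Set B := {s | s ∈ I ∧ ∃ k ∈ J, cs.simple s * X.delta C D = X.delta C D * cs.simple k}
    have hE' : X.delta C E ∈ cs.par L := hE
    have hER : E ∈ R := hR.mem_of_delta h.1 (par_mono (fun s hs => hs.1) hE')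
    set k := (X.delta C D)⁻¹ * X.delta C E * X.delta C D with hk
    have hkJ : k ∈ cs.par J := by
      have h1 := (mem_par_conjSet (H := L) (w := X.delta C D) (x := k)
        (fun j hj => ⟨_, hj.2.choose_spec.2⟩)).2 (by rw [hk]; simpa [mul_assoc] using hE')
      refine (Subgroup.closure_le _).2 ?_ h1
      rintro _ ⟨k', ⟨j, ⟨-, k'', hk'', e⟩, e'⟩, rfl⟩
      rw [e] at e'
      rw [← mul_left_cancel e']
      exact simple_mem_par hk''
    have h1 := (hR.btw_gate D hER).symm
    rw [h.2.2.1] at h1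
    have h2 : X.delta E D = X.delta C D * k⁻¹ := by
      rw [h1.delta_eq, delta_symm C E, hk]; group
    obtain ⟨F, hF, hF'⟩ := exists_btw_mul (h.rRed hT _ (inv_mem hkJ)) h2
    have hFT : F ∈ T := hT.mem_of_delta h.2.1 (by rw [delta_symm, hF', inv_inv]; exact hkJ)
    refine ⟨F, hFT, gate_eq_of_rRed hR hER ?_⟩
    rw [delta_symm, hF, ← lRed_iff]
    exact h.lRed hR

theorem Res.exists_isRes (R : X.Res) : ∃ I, SphType cs I ∧ X.IsRes I R.1 := by
  obtain ⟨I, C, hI, h⟩ := R.2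
  exact ⟨I, hI, C, h⟩

theorem sphType_mono {I J : Set B} (h : cs.par I ≤ cs.par J) (hJ : SphType cs J) :
    SphType cs I := Set.Finite.subset hJ h

theorem projRes_val (R T : X.Res) : (X.projRes R T).1 = X.projSet R.1 T.1 := by
  refine Classical.epsilon_spec (p := fun U : X.Res => U.1 = X.projSet R.1 T.1) ?_
  obtain ⟨I, hI, hR⟩ := R.exists_isRes
  obtain ⟨J, -, hT⟩ := T.exists_isRes
  obtain ⟨C, D, h⟩ := exists_mutual hR hT
  refine ⟨⟨_, _, _, sphType_mono (par_mono fun s hs => ?_) hI, h.projSet_eq hR hT⟩, rfl⟩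
  exact hs.1

theorem mem_projRes {R T : X.Res} {C : X.Chamber} :
    C ∈ (X.projRes R T).1 ↔ ∃ D ∈ T.1, X.gate R.1 D = C := by
  rw [projRes_val]; rfl

end Bldg

namespace Bldg

open CoxeterSystem

variable {cs : CoxeterSystem M W} {X : Bldg cs}

theorem Res.nonempty (R : X.Res) : R.1.Nonempty := by
  obtain ⟨_, -, h⟩ := R.exists_isRes
  exact h.nonempty

theorem Res.gate_mem (R : X.Res) (C : X.Chamber) : X.gate R.1 C ∈ R.1 := by
  obtain ⟨_, -, h⟩ := R.exists_isRes
  exact h.gate_mem C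

theorem Res.btw_gate (R : X.Res) (C : X.Chamber) {E : X.Chamber} (hE : E ∈ R.1) :
    Btw C (X.gate R.1 C) E := by
  obtain ⟨_, -, h⟩ := R.exists_isRes
  exact h.btw_gate C hE

theorem Res.gate_of_mem (R : X.Res) {C : X.Chamber} (hC : C ∈ R.1) : X.gate R.1 C = C := by
  obtain ⟨_, -, h⟩ := R.exists_isRes
  exact h.gate_of_mem hC

theorem Res.gate_eq_of_btw (R : X.Res) {C D : X.Chamber} (h : Btw C D (X.gate R.1 C)) :
    X.gate R.1 D = X.gate R.1 C := by
  obtain ⟨_, -, hR⟩ := R.exists_isRes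
  exact hR.gate_eq_of_btw h

theorem projRes_subset (R T : X.Res) : (X.projRes R T).1 ⊆ R.1 := by
  intro C hC
  obtain ⟨D, -, rfl⟩ := mem_projRes.1 hC
  exact R.gate_mem D

/-! ### Equivariance -/

theorem delta_act (g : X.Aut) (C D : X.Chamber) : X.delta (g.1 C) (g.1 D) = X.delta C D := g.2 C D

theorem btw_act (g : X.Aut) {C D E : X.Chamber} :
    Btw (g.1 C) (g.1 D) (g.1 E) ↔ Btw C D E := by
  simp only [Btw, gdist, delta_act]

theorem image_residue (g : X.Aut) (J : Set B) (C : X.Chamber) :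
    g.1 '' X.residue J C = X.residue J (g.1 C) := by
  ext D
  constructor
  · rintro ⟨E, hE, rfl⟩
    rw [mem_residue, delta_act]
    exact hE
  · intro hD
    refine ⟨g.1⁻¹ D, ?_, by simp⟩
    have h : g.1 (g.1⁻¹ D) = D := by simp
    rw [mem_residue, ← delta_act g, h]
    exact hD

theorem IsRes.image {J : Set B} {R : Set X.Chamber} (hR : X.IsRes J R) (g : X.Aut) :
    X.IsRes J (g.1 '' R) := by
  obtain ⟨C, rfl⟩ := hR
  exact ⟨_, image_residue g J C⟩

theorem Res.gate_act (R : X.Res) (g : X.Aut) (C : X.Chamber) :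
    X.gate (g.1 '' R.1) (g.1 C) = g.1 (X.gate R.1 C) := by
  refine gate_eq ⟨_, R.gate_mem C, rfl⟩ ?_
  rintro _ ⟨E, hE, rfl⟩
  rw [btw_act]
  exact R.btw_gate C hE

theorem actRes_val (g : X.Aut) (R : X.Res) : (X.actRes g R).1 = g.1 '' R.1 := by
  refine Classical.epsilon_spec (p := fun T : X.Res => T.1 = g.1 '' R.1) ?_
  obtain ⟨I, C, hI, h⟩ := R.2
  exact ⟨⟨_, I, g.1 C, hI, rfl⟩, by rw [h, image_residue]⟩

theorem act_mem_actRes {g : X.Aut} {R : X.Res} {C : X.Chamber} :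
    g.1 C ∈ (X.actRes g R).1 ↔ C ∈ R.1 := by
  rw [actRes_val]
  exact g.1.injective.mem_set_image

theorem actRes_mul (g h : X.Aut) (R : X.Res) :
    X.actRes (g * h) R = X.actRes g (X.actRes h R) := by
  apply Subtype.ext
  simp only [actRes_val, Subgroup.coe_mul, ← Set.image_comp]
  rfl

theorem actRes_one (R : X.Res) : X.actRes 1 R = R := by
  apply Subtype.ext
  rw [actRes_val]
  simp

theorem actRes_inv_actRes (g : X.Aut) (R : X.Res) : X.actRes g⁻¹ (X.actRes g R) = R := by
  rw [← actRes_mul, inv_mul_cancel, actRes_one]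

theorem actRes_actRes_inv (g : X.Aut) (R : X.Res) : X.actRes g (X.actRes g⁻¹ R) = R := by
  rw [← actRes_mul, mul_inv_cancel, actRes_one]

theorem actRes_projRes (g : X.Aut) (σ R : X.Res) :
    X.actRes g (X.projRes σ R) = X.projRes (X.actRes g σ) (X.actRes g R) := by
  apply Subtype.ext
  ext C
  simp only [actRes_val, projRes_val, projSet, Set.mem_image]
  constructor
  · rintro ⟨_, ⟨D, hD, rfl⟩, rfl⟩
    exact ⟨_, ⟨D, hD, rfl⟩, σ.gate_act g D⟩
  · rintro ⟨_, ⟨D, hD, rfl⟩, rfl⟩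
    exact ⟨_, ⟨D, hD, rfl⟩, (σ.gate_act g D).symm⟩

theorem actCr_eq_iff {g : X.Aut} {ξ : X.Res → X.Res} :
    X.actCr g ξ = ξ ↔ ∀ σ, ξ (X.actRes g σ) = X.actRes g (ξ σ) := by
  constructor
  · intro h σ
    have := congrFun h (X.actRes g σ)
    rw [actCr, actRes_inv_actRes] at this
    exact this.symm
  · intro h
    funext σ
    rw [actCr, ← h, actRes_actRes_inv]

theorem actCr_inv {g : X.Aut} {ξ : X.Res → X.Res} (h : X.actCr g ξ = ξ) :
    X.actCr g⁻¹ ξ = ξ := by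
  rw [actCr_eq_iff] at h ⊢
  intro σ
  have := h (X.actRes g⁻¹ σ)
  rw [actRes_actRes_inv] at this
  rw [this, actRes_inv_actRes]

theorem actCr_mul {g h : X.Aut} {ξ : X.Res → X.Res} (hg : X.actCr g ξ = ξ)
    (hh : X.actCr h ξ = ξ) : X.actCr (g * h) ξ = ξ := by
  rw [actCr_eq_iff] at *
  intro σ
  rw [actRes_mul, hg, hh, actRes_mul]

theorem actCr_one (ξ : X.Res → X.Res) : X.actCr 1 ξ = ξ := by
  rw [actCr_eq_iff]
  intro σ
  rw [actRes_one, actRes_one]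

/-! ### Local finiteness -/

theorem LocallyFinite.finite_delta_eq (hX : X.LocallyFinite) (C : X.Chamber) (w : W) :
    {D | X.delta C D = w}.Finite := by
  have : ∀ n, ∀ w, cs.length w = n → {D | X.delta C D = w}.Finite := by
    intro n
    induction n with
    | zero =>
      intro w hw
      rw [length_eq_zero_iff] at hw
      refine (Set.finite_singleton C).subset fun D hD => ?_
      exact ((X.delta_eq_one_iff C D).1 (hD.trans hw)).symm
    | succ n ih =>
      intro w hw
      obtain ⟨i, hi⟩ := cs.exists_rightDescent_of_ne_one (w := w) (by rintro rfl; simp at hw)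
      have h1 := cs.isRightDescent_iff.1 hi
      refine ((ih (w * cs.simple i) (by omega)).biUnion
        (fun D _ => hX.2 (X.residue {i} D) ⟨i, D, rfl⟩)).subset fun E hE => ?_
      obtain ⟨D, hD, hD'⟩ := X.exists_delta C E i
      refine Set.mem_biUnion (x := D) ?_ ?_
      · rw [Set.mem_ofPred_eq, hD', hE]
      · rw [mem_residue, X.delta_simple_symm hD]
        exact simple_mem_par rfl
  exact this _ w rfl

theorem LocallyFinite.finite_res (hX : X.LocallyFinite) (R : X.Res) : R.1.Finite := by
  obtain ⟨I, C, hI, h⟩ := R.2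
  rw [h]
  refine (Set.Finite.biUnion hI fun w _ => hX.finite_delta_eq C w).subset fun D hD => ?_
  exact Set.mem_biUnion (x := X.delta C D) hD rfl

/-! ### Flows towards a residue -/

variable (X) in
/-- `d` lies on a minimal gallery from `c` to any chamber of `R`. -/
def Flow (R : Set X.Chamber) (c d : X.Chamber) : Prop := ∀ D ∈ R, Btw c d D

theorem Res.flow_iff (R : X.Res) {c d : X.Chamber} :
    X.Flow R.1 c d ↔ Btw c d (X.gate R.1 c) :=
  ⟨fun h => h _ (R.gate_mem c), fun h _ hD => ((R.btw_gate c hD).trans_left h).1⟩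

theorem flow_refl (R : Set X.Chamber) (c : X.Chamber) : X.Flow R c c := fun D _ => btw_left c D

theorem Flow.trans {R : Set X.Chamber} {c d e : X.Chamber} (h : X.Flow R c d)
    (h' : X.Flow R d e) : X.Flow R c e := fun D hD => ((h D hD).trans_right (h' D hD)).1

theorem Flow.of_btw {R : Set X.Chamber} {c d e : X.Chamber} (h : X.Flow R c e)
    (h' : Btw c d e) : X.Flow R c d := fun D hD => ((h D hD).trans_left h').1

theorem Flow.of_btw_right {R : Set X.Chamber} {c d e : X.Chamber} (h : X.Flow R c e)
    (h' : Btw c d e) : X.Flow R d e := fun D hD => ((h D hD).trans_left h').2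

theorem Flow.gate_eq {R : X.Res} {c d : X.Chamber} (h : X.Flow R.1 c d) :
    X.gate R.1 d = X.gate R.1 c := R.gate_eq_of_btw (R.flow_iff.1 h)

theorem Flow.btw {R : X.Res} {c d e : X.Chamber} (h : X.Flow R.1 c d)
    (h' : X.Flow R.1 d e) : Btw c d e := by
  obtain ⟨D, hD⟩ := R.nonempty
  exact ((h D hD).trans_right (h' D hD)).2

theorem flow_act {g : X.Aut} {R : X.Res} {c d : X.Chamber} :
    X.Flow (X.actRes g R).1 (g.1 c) (g.1 d) ↔ X.Flow R.1 c d := by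
  simp only [Flow, actRes_val, Set.forall_mem_image, btw_act]

variable (X) in
/-- Every chamber of `x` flows into the residue `z` on its way to `R`. -/
def Leads (R x z : X.Res) : Prop := ∀ c ∈ x.1, X.Flow R.1 c (X.gate z.1 c)

theorem leads_iff {R x z : X.Res} :
    X.Leads R x z ↔ ∀ c ∈ x.1, ∃ d ∈ z.1, X.Flow R.1 c d :=
  ⟨fun h c hc => ⟨_, z.gate_mem c, h c hc⟩,
    fun h c hc => by
      obtain ⟨d, hd, hcd⟩ := h c hc
      exact hcd.of_btw (z.btw_gate c hd)⟩

theorem convexResSet_leads (R x : X.Res) : X.ConvexResSet {z | X.Leads R x z} := by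
  simp only [ConvexResSet, ClosedResSet, Set.mem_ofPred_eq, leads_iff]
  constructor
  · intro z z' h h' c hc
    obtain ⟨d, hd, hcd⟩ := h' c hc
    exact ⟨d, h hd, hcd⟩
  · intro z h z' h' c hc
    obtain ⟨d, hd, hcd⟩ := h c hc
    obtain ⟨d', hd', hcd'⟩ := h' c hc
    exact ⟨_, mem_projRes.2 ⟨d', hd', rfl⟩, fun D hD =>
      (hcd' D hD).convex (hcd D hD) (z.btw_gate d' hd)⟩

theorem conv2_subset_leads (x R : X.Res) : X.conv2 x R ⊆ {z | X.Leads R x z} := by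
  refine Set.sInter_subset_of_mem ⟨convexResSet_leads R x, ?_⟩
  rintro z (rfl | rfl)
  · exact leads_iff.2 fun c hc => ⟨c, hc, flow_refl _ c⟩
  · exact fun c _ D hD => Res.btw_gate _ c hD

/-! ### Stationary residues -/

theorem projRes_projRes (σ R : X.Res) :
    X.projRes (X.projRes σ R) R = X.projRes σ R := by
  have key : ∀ D ∈ R.1, X.gate (X.projRes σ R).1 D = X.gate σ.1 D := fun D hD =>
    gate_eq (mem_projRes.2 ⟨D, hD, rfl⟩) fun E hE => σ.btw_gate D (projRes_subset _ _ hE)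
  apply Subtype.ext
  ext C
  rw [mem_projRes, mem_projRes]
  exact ⟨fun ⟨D, hD, h⟩ => ⟨D, hD, (key D hD).symm.trans h⟩,
    fun ⟨D, hD, h⟩ => ⟨D, hD, (key D hD).trans h⟩⟩

theorem exists_gate_eq {y R : X.Res} (hy : X.projRes y R = y) {f : X.Chamber} (hf : f ∈ y.1) :
    ∃ D ∈ R.1, X.gate y.1 D = f := by
  rw [← hy] at hf
  exact mem_projRes.1 hf

theorem leads_projRes (x R : X.Res) : X.Leads R x (X.projRes x R) := by
  rw [leads_iff]
  intro c hc
  refine ⟨_, mem_projRes.2 ⟨X.gate R.1 c, R.gate_mem c, rfl⟩, R.flow_iff.2 ?_⟩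
  exact (x.btw_gate _ hc).symm

theorem gate_eq_of_flow {y R : X.Res} (hy : X.projRes y R = y) {c f : X.Chamber}
    (hf : f ∈ y.1) (hc : X.Flow R.1 c f) : X.gate y.1 c = f := by
  obtain ⟨D, hD, h⟩ := exists_gate_eq hy (y.gate_mem c)
  have h1 := hc D hD
  have h2 := y.btw_gate c hf
  have h3 := (y.btw_gate D hf).symm
  rw [h] at h3
  have h4 := gdist_triangle c (X.gate y.1 c) D
  rw [Btw] at *
  rw [gdist_symm f (X.gate y.1 c)] at h3
  exact gdist_eq_zero.1 (by omega)

theorem mutual_of_flow {y R : X.Res} (hy : X.projRes y R = y) {c f : X.Chamber}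
    (hf : f ∈ y.1) (hc : X.Flow R.1 c f) : X.Mutual y.1 R.1 f (X.gate R.1 c) := by
  refine ⟨hf, R.gate_mem c, ?_, hc.gate_eq⟩
  rw [← gate_eq_of_flow hy hf hc]
  refine (gate_eq_of_flow hy (y.gate_mem _) (R.flow_iff.2 ?_)).symm
  refine ((R.flow_iff.1 hc).trans_right (y.btw_gate _ hf).symm).1

theorem mutual_of_mem {y R : X.Res} (hy : X.projRes y R = y) {f : X.Chamber}
    (hf : f ∈ y.1) : X.Mutual y.1 R.1 f (X.gate R.1 f) :=
  mutual_of_flow hy hf (flow_refl _ f)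

theorem Leads.antisymm {y z R : X.Res} (hy : X.projRes y R = y) (hz : X.projRes z R = z)
    (h : X.Leads R y z) (h' : X.Leads R z y) : y = z := by
  have key : ∀ {y z : X.Res}, X.projRes y R = y → X.Leads R y z → X.Leads R z y →
      y.1 ⊆ z.1 := by
    intro y z hy h h' c hc
    have h1 := h c hc
    have h2 := h' _ (z.gate_mem c)
    have h3 := gate_eq_of_flow hy (y.gate_mem _) (h1.trans h2)
    rw [y.gate_of_mem hc] at h3
    have h4 := h1.btw h2
    rw [← h3, Btw, gdist_self] at h4
    rw [gdist_eq_zero.1 (show X.gdist c (X.gate z.1 c) = 0 by omega)]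
    exact z.gate_mem c
  exact Subtype.ext ((key hy h h').antisymm (key hz h' h))

theorem projRes_eq_of_leads {σ z R : X.Res} (hz : X.projRes z R = z)
    (h : X.Leads R (X.projRes σ R) z) : X.projRes σ z = X.projRes σ R := by
  have key : ∀ D ∈ R.1, X.gate σ.1 (X.gate z.1 D) = X.gate σ.1 D := by
    intro D hD
    apply σ.gate_eq_of_btw
    have h1 := h _ (mem_projRes.2 ⟨D, hD, rfl⟩) D hD
    exact (h1.symm.trans_left (z.btw_gate D (z.gate_mem _))).1
  apply Subtype.ext
  ext C
  rw [mem_projRes, mem_projRes]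
  constructor
  · rintro ⟨d, hd, rfl⟩
    obtain ⟨D, hD, rfl⟩ := exists_gate_eq hz hd
    exact ⟨D, hD, (key D hD).symm⟩
  · rintro ⟨D, hD, rfl⟩
    exact ⟨_, z.gate_mem D, key D hD⟩

end Bldg

namespace CoxeterSystem

variable (cs : CoxeterSystem M W)

/-- Conjugation by `w⁻¹` maps `W_H` into `W_K`. -/
def ConjInto (H : Set B) (w : W) (K : Set B) : Prop := ∀ h ∈ cs.par H, w⁻¹ * h * w ∈ cs.par K

variable {cs}

theorem conjInto_of_simple {H K : Set B} {w : W}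
    (h : ∀ j ∈ H, w⁻¹ * cs.simple j * w ∈ cs.par K) : cs.ConjInto H w K := by
  intro x hx
  have : cs.par H ≤ (cs.par K).comap (MulAut.conj w⁻¹).toMonoidHom := by
    conv_lhs => rw [par]
    rw [Subgroup.closure_le]
    rintro _ ⟨j, hj, rfl⟩
    simpa using h j hj
  simpa using this hx

theorem ConjInto.sphType {H K : Set B} {w : W} (h : cs.ConjInto H w K) (hK : SphType cs K) :
    SphType cs H := by
  refine Set.Finite.of_finite_image (f := fun x => w⁻¹ * x * w) (Set.Finite.subset hK ?_) ?_
  · rintro _ ⟨x, hx, rfl⟩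
    exact h x hx
  · intro x _ y _ hxy
    simpa using hxy

theorem Par.conjInto {H : Set B} {w : W} (h : cs.Par H w) :
    cs.ConjInto H w (cs.conjSet H w) := by
  intro x hx
  rw [h.mem_par_conjSet]
  simpa [mul_assoc] using hx

theorem Par.conjInto_conjSet {H K : Set B} {w v : W} (h : cs.Par H w)
    (h' : cs.ConjInto H (w * v) K) : cs.ConjInto (cs.conjSet H w) v K := by
  intro x hx
  rw [h.mem_par_conjSet] at hx
  have := h' _ hx
  simpa [mul_assoc] using this

theorem ConjInto.mono_right {H K K' : Set B} {w : W} (h : cs.ConjInto H w K) (hK : K ⊆ K') :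
    cs.ConjInto H w K' := fun x hx => par_mono hK (h x hx)

end CoxeterSystem

namespace Bldg

open CoxeterSystem

variable {cs : CoxeterSystem M W} {X : Bldg cs}

theorem conjInto_of_mutual {L K : Set B} {y R : X.Res} (hL : X.IsRes L y.1) (hK : X.IsRes K R.1)
    (hy : X.projRes y R = y) {t C : X.Chamber} (h : X.Mutual y.1 R.1 t C) :
    cs.ConjInto L (X.delta t C) K := by
  intro x hx
  obtain ⟨E, rfl⟩ := exists_delta_eq t x
  have hE := hL.mem_of_delta h.1 hx
  have h1 := mutual_of_mem hy hE
  rw [mul_assoc, (h.delta_eq hL hK h1).2, inv_mul_cancel_left]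
  exact hK.delta_mem h.2.1 h1.2.1

theorem par_of_mutual {L K : Set B} {y R : X.Res} (hL : X.IsRes L y.1) (hK : X.IsRes K R.1)
    (hy : X.projRes y R = y) {t C : X.Chamber} (h : X.Mutual y.1 R.1 t C) :
    cs.Par L (X.delta t C) :=
  par_of_conj_mem (h.lRed hL) (h.rRed hK) fun _ hj =>
    conjInto_of_mutual hL hK hy h _ (simple_mem_par hj)

theorem projRes_eq_of_conjInto {L K : Set B} {y R : X.Res} (hL : X.IsRes L y.1)
    (hK : X.IsRes K R.1) {t C : X.Chamber} (ht : t ∈ y.1) (hC : C ∈ R.1)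
    (hl : cs.LRed L (X.delta t C)) (hr : cs.RRed K (X.delta t C))
    (h : cs.ConjInto L (X.delta t C) K) : X.projRes y R = y := by
  apply Subtype.ext
  refine (projRes_subset y R).antisymm fun E hE => ?_
  have h1 := hL.delta_mem ht hE
  set w := X.delta t C with hw
  have h2 := h _ (inv_mem h1)
  have h3 : X.delta E C = w * (w⁻¹ * (X.delta t E)⁻¹ * w) := by
    have := (delta_eq_mul_of_red (X := X) (C := E) (D := t) (E := C)
      (hl _ (hL.delta_mem hE ht)))
    rw [this, delta_symm t E, hw]
    group
  obtain ⟨F, hF, hF'⟩ := exists_btw_mul (hr _ h2) h3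
  refine mem_projRes.2 ⟨F, hK.mem_of_delta hC ?_, ?_⟩
  · rw [delta_symm, hF']
    exact inv_mem h2
  · refine gate_eq_of_rRed hL hE ?_
    rw [delta_symm, hF, ← lRed_iff]
    exact hl

theorem leads_of_conjInto {H L : Set B} {y z R : X.Res} (hH : X.IsRes H z.1) (hL : X.IsRes L y.1)
    (hy : X.projRes y R = y) {r t : X.Chamber} (hr : r ∈ z.1) (ht : t ∈ y.1)
    (hf : X.Flow R.1 r t) (hp : cs.Par H (X.delta r t))
    (hc : cs.ConjInto H (X.delta r t) L) : X.Leads R z y := by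
  obtain ⟨K, -, hK⟩ := R.exists_isRes
  have hRed := (R.flow_iff.1 hf).red
  rw [leads_iff]
  intro e he
  set w := X.delta r t with hw
  have h1 := hH.delta_mem hr he
  have h2 := hc _ (inv_mem h1)
  have h3 : X.delta e t = w * (w⁻¹ * (X.delta r e)⁻¹ * w) := by
    rw [delta_eq_mul_of_red (X := X) (C := e) (D := r) (E := t)
      (hp.lRed _ (hH.delta_mem he hr)), delta_symm r e, hw]
    group
  have h4 : w⁻¹ * (X.delta r e)⁻¹ * w ∈ cs.par (cs.conjSet H w) := by
    rw [hp.mem_par_conjSet]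
    simpa [mul_assoc] using h1
  obtain ⟨E, hE, hE'⟩ := exists_btw_mul (hp.rRed _ h4) h3
  have hEy : E ∈ y.1 := hL.mem_of_delta ht (by rw [delta_symm, hE']; exact inv_mem h2)
  refine ⟨E, hEy, R.flow_iff.2 ?_⟩
  have h5 := mutual_of_mem hy ht
  have h6 := mutual_of_mem hy hEy
  have h7 := (h5.delta_eq hL hK h6).1
  rw [hf.gate_eq] at h5 h7
  have h8 : Btw e E (X.gate R.1 E) := by
    rw [btw_iff_red, h7, hE]
    exact hRed
  rw [show X.gate R.1 e = X.gate R.1 E from ?_]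
  · exact h8
  refine gate_eq_of_rRed hK (R.gate_mem E) ?_
  rw [h8.delta_eq, h7, hE, ← (R.flow_iff.1 hf).delta_eq]
  exact (hK.gate_spec r).2.2

/-! ### The filter of residues converging to a boundary point -/

/-- The filter of residues converging to `ξ`. -/
def toward (ξ : X.Res → X.Res) : Filter X.Res := comap X.projr (𝓝 ξ)

variable {ξ : X.Res → X.Res}

theorem toward_neBot (hξ : ξ ∈ X.Cr) : (toward ξ).NeBot := by
  rw [toward, comap_neBot_iff]
  intro t ht
  obtain ⟨_, h, R, rfl⟩ := mem_closure_iff_nhds.1 hξ t ht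
  exact ⟨R, h⟩

theorem tendsto_toward {R : ℕ → X.Res} (h : X.ConvSeq ξ R) : Tendsto R atTop (toward ξ) :=
  tendsto_comap_iff.2 h

theorem eventually_projRes_eq (ξ : X.Res → X.Res) (σ : X.Res) :
    ∀ᶠ R in toward ξ, X.projRes σ R = ξ σ := by
  have h : Tendsto X.projr (toward ξ) (𝓝 ξ) := tendsto_comap
  have h2 := tendsto_pi_nhds.1 h σ
  rw [nhds_discrete, tendsto_pure] at h2
  exact h2

theorem eq_simple_of_mem_par_singleton {i : B} {w : W} (h : w ∈ cs.par {i}) :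
    w = 1 ∨ w = cs.simple i := by
  refine par_induction (J := {i}) (p := fun w => w = 1 ∨ w = cs.simple i) (Or.inl rfl) ?_ w h
  rintro j rfl v _ _ (rfl | rfl)
  · simp
  · simp

/-- Whether the first step of a gallery is directed towards `R` is seen by the projection to a
panel. -/
theorem flow_iff_projRes_panel {R P : X.Res} {c d : X.Chamber} {i : B} (hP : X.IsRes {i} P.1)
    (hc : c ∈ P.1) (hcd : X.delta c d = cs.simple i) :
    X.Flow R.1 c d ↔ (X.projRes P R).1 = {d} := by
  have hd : d ∈ P.1 := hP.mem_of_delta hc (by rw [hcd]; exact simple_mem_par rfl)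
  have key : ∀ D, Btw c d D ↔ X.gate P.1 D = d := by
    intro D
    constructor
    · intro h
      have h1 := P.btw_gate D hd
      have h2 := P.btw_gate D hc
      have h3 : X.gdist (X.gate P.1 D) c ≤ 1 := by
        rcases eq_simple_of_mem_par_singleton (hP.delta_mem (P.gate_mem D) hc) with h | h
        · simp [gdist, h]
        · simp [gdist, h]
      have h4 : X.gdist d c = 1 := by
        rw [gdist_symm, gdist, hcd, length_simple]
      have h5 := h.symm
      rw [Btw] at h1 h2 h5
      apply gdist_eq_zero.1
      omega
    · intro h
      have h1 := P.btw_gate D hc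
      rw [h] at h1
      exact h1.symm
  simp only [Flow, key]
  constructor
  · intro h
    ext E
    rw [mem_projRes, Set.mem_singleton_iff]
    constructor
    · rintro ⟨D, hD, rfl⟩
      exact h D hD
    · rintro rfl
      obtain ⟨D, hD⟩ := R.nonempty
      exact ⟨D, hD, h D hD⟩
  · intro h D hD
    have : X.gate P.1 D ∈ (X.projRes P R).1 := mem_projRes.2 ⟨D, hD, rfl⟩
    rw [h] at this
    exact this

theorem sphType_singleton (i : B) : SphType cs {i} := by
  refine Set.Finite.subset (Set.toFinite {1, cs.simple i}) fun w hw => ?_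
  exact eq_simple_of_mem_par_singleton hw

theorem eventually_flow_of_frequently {c d : X.Chamber}
    (h : ∃ᶠ R in toward ξ, X.Flow R.1 c d) : ∀ᶠ R in toward ξ, X.Flow R.1 c d := by
  induction hn : X.gdist c d generalizing c with
  | zero =>
    rw [gdist_eq_zero.1 hn]
    exact Eventually.of_forall fun R => flow_refl _ _
  | succ n ih =>
    have hne : d ≠ c := by
      rintro rfl
      simp at hn
    obtain ⟨e, i, h1, h2, h3⟩ := X.exists_last d hne
    have h1' := X.delta_simple_symm h1
    have hb : Btw c e d := by
      rw [← h1, ← btw_iff_red] at h3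
      exact h3.symm
    have hl : X.gdist c e = 1 := by rw [gdist, h1', length_simple]
    have he := ih (c := e) (h.mono fun R hR => hR.of_btw_right hb) (by rw [Btw] at hb; omega)
    let P : X.Res := ⟨X.residue {i} c, {i}, c, sphType_singleton i, rfl⟩
    have hP : X.IsRes {i} P.1 := isRes_residue _ _
    have hc : c ∈ P.1 := mem_residue_self _ _
    obtain ⟨R, hR, hR'⟩ := (h.and_eventually (eventually_projRes_eq ξ P)).exists
    have hξ := (flow_iff_projRes_panel hP hc h1').1 (hR.of_btw hb)
    rw [hR'] at hξ
    filter_upwards [he, eventually_projRes_eq ξ P] with R hR hR'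
    refine ((flow_iff_projRes_panel hP hc h1').2 ?_).trans hR
    rw [hR', hξ]

variable (ξ) in
/-- Every chamber of `x` flows into the residue `z` on its way to the boundary point `ξ`. -/
def LeadsTo (x z : X.Res) : Prop := ∀ c ∈ x.1, ∀ᶠ R in toward ξ, X.Flow R.1 c (X.gate z.1 c)

theorem leadsTo_of_frequently {x z : X.Res} (h : ∃ᶠ R in toward ξ, X.Leads R x z) :
    LeadsTo ξ x z := fun c hc =>
  eventually_flow_of_frequently (h.mono fun _ hR => hR c hc)

theorem LeadsTo.trans {x y z : X.Res} (h : LeadsTo ξ x y) (h' : LeadsTo ξ y z) :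
    LeadsTo ξ x z := by
  intro c hc
  filter_upwards [h c hc, h' _ (y.gate_mem c)] with R h1 h2
  exact (h1.trans h2).of_btw (z.btw_gate c (z.gate_mem _))

theorem eventually_leads (hX : X.LocallyFinite) {x z : X.Res} (h : LeadsTo ξ x z) :
    ∀ᶠ R in toward ξ, X.Leads R x z :=
  (eventually_all_finite (hX.finite_res x)).2 h

theorem xi_subset (hξ : ξ ∈ X.Cr) (σ : X.Res) : (ξ σ).1 ⊆ σ.1 := by
  have := toward_neBot hξ
  obtain ⟨R, hR⟩ := (eventually_projRes_eq ξ σ).exists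
  rw [← hR]
  exact projRes_subset σ R

theorem xi_xi (hξ : ξ ∈ X.Cr) (σ : X.Res) : ξ (ξ σ) = ξ σ := by
  have := toward_neBot hξ
  obtain ⟨R, hR, hR'⟩ :=
    ((eventually_projRes_eq ξ σ).and (eventually_projRes_eq ξ (ξ σ))).exists
  rw [← hR', ← hR, projRes_projRes]

theorem leadsTo_xi (hξ : ξ ∈ X.Cr) (x : X.Res) : LeadsTo ξ x (ξ x) := by
  have := toward_neBot hξ
  refine leadsTo_of_frequently (Eventually.frequently ?_)
  filter_upwards [eventually_projRes_eq ξ x] with R hR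
  rw [← hR]
  exact leads_projRes x R

theorem leadsTo_of_subset {x y z : X.Res} (h : LeadsTo ξ x z) (hyx : y.1 ⊆ x.1) :
    LeadsTo ξ y z := fun c hc => h c (hyx hc)

theorem LeadsTo.antisymm (hX : X.LocallyFinite) (hξ : ξ ∈ X.Cr) {y z : X.Res} (hy : ξ y = y)
    (hz : ξ z = z) (h : LeadsTo ξ y z) (h' : LeadsTo ξ z y) : y = z := by
  have := toward_neBot hξ
  obtain ⟨R, h1, h2, h3, h4⟩ := ((eventually_leads hX h).and ((eventually_leads hX h').and
    ((eventually_projRes_eq ξ y).and (eventually_projRes_eq ξ z)))).exists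
  rw [hy] at h3
  rw [hz] at h4
  exact h1.antisymm h3 h4 h2

theorem projRes_eq_xi (hX : X.LocallyFinite) (hξ : ξ ∈ X.Cr) {σ z : X.Res} (hz : ξ z = z)
    (h : LeadsTo ξ (ξ σ) z) : X.projRes σ z = ξ σ := by
  have := toward_neBot hξ
  obtain ⟨R, h1, h2, h3⟩ := ((eventually_leads hX h).and
    ((eventually_projRes_eq ξ z).and (eventually_projRes_eq ξ σ))).exists
  rw [hz] at h2
  rw [← h3] at h1 ⊢
  exact projRes_eq_of_leads h2 h1

theorem LeadsTo.of_mem_qsector (hseq : ∃ R : ℕ → X.Res, X.ConvSeq ξ R)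
    {x z : X.Res} (h : z ∈ X.Qsector x ξ) : LeadsTo ξ x z := by
  have h1 := tendsto_toward (Classical.epsilon_spec hseq)
  obtain ⟨k, hk⟩ := Set.mem_iUnion.1 h
  refine leadsTo_of_frequently (h1.frequently (Eventually.frequently ?_))
  filter_upwards [eventually_ge_atTop k] with n hn
  exact conv2_subset_leads _ _ (Set.mem_iInter₂.1 hk n hn)

/-! ### Least upper bounds -/

theorem exists_least_leadsTo (hX : X.LocallyFinite) (hξ : ξ ∈ X.Cr) {ι : Type} [Finite ι] [Nonempty ι]
    (c : X.Chamber) (z : ι → X.Res) (hz : ∀ i, ξ (z i) = z i)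
    (hc : ∀ i, ∀ᶠ R in toward ξ, X.Flow R.1 c (X.gate (z i).1 c)) :
    ∃ m, ξ m = m ∧ (∀ i, LeadsTo ξ (z i) m) ∧
      ∀ y, ξ y = y → (∀ i, LeadsTo ξ (z i) y) → LeadsTo ξ m y := by
  have := toward_neBot hξ
  choose I hIs hI using fun i => (z i).exists_isRes
  set d : ι → X.Chamber := fun i => X.gate (z i).1 c with hd
  set u : ι → W := fun i => X.delta c (d i) with hu
  have hdz : ∀ i, d i ∈ (z i).1 := fun i => (z i).gate_mem c
  let P : W → Prop := fun v => ∀ i, cs.Wle (u i) v ∧ cs.Par (I i) ((u i)⁻¹ * v)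
  have hgood : ∀ᶠ R in toward ξ,
      ∀ i, X.projRes (z i) R = z i ∧ X.Flow R.1 c (d i) := by
    refine eventually_all.2 fun i => ?_
    filter_upwards [hc i, eventually_projRes_eq ξ (z i)] with R h1 h2
    exact ⟨h2.trans (hz i), h1⟩
  have hmut : ∀ {R : X.Res} {i}, X.projRes (z i) R = z i → X.Flow R.1 c (d i) →
      X.Mutual (z i).1 R.1 (d i) (X.gate R.1 c) := fun h1 h2 => mutual_of_flow h1 (hdz _) h2
  have hdel : ∀ {R : X.Res} {i}, X.Flow R.1 c (d i) →
      X.delta (d i) (X.gate R.1 c) = (u i)⁻¹ * X.delta c (X.gate R.1 c) :=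
    fun h2 => (h2 _ (Res.gate_mem _ c)).delta_right
  have hPR : ∀ {R : X.Res}, (∀ i, X.projRes (z i) R = z i ∧ X.Flow R.1 c (d i)) →
      P (X.delta c (X.gate R.1 c)) := by
    intro R hR i
    obtain ⟨K, -, hK⟩ := R.exists_isRes
    refine ⟨((hR i).2 _ (R.gate_mem c)).wle, ?_⟩
    rw [← hdel (hR i).2]
    exact par_of_mutual (hI i) hK (hR i).1 (hmut (hR i).1 (hR i).2)
  obtain ⟨v, hvP, hvle⟩ : ∃ v, P v ∧ ∀ v', P v' → cs.Wle v v' := by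
    obtain ⟨R, hR⟩ := hgood.exists
    exact exists_least_transporter u I ⟨_, hPR hR⟩
  -- a chamber in position `v` through which the flow from `c` passes
  obtain ⟨t, htv, ht⟩ : ∃ t, X.delta c t = v ∧ ∀ᶠ R in toward ξ, X.Flow R.1 c t := by
    by_contra hcon
    have h1 : ∀ t ∈ {t | X.delta c t = v}, ∀ᶠ R in toward ξ, ¬ X.Flow R.1 c t := by
      intro t ht
      by_contra h2
      exact hcon ⟨t, ht, eventually_flow_of_frequently h2⟩
    obtain ⟨R, h2, h3⟩ :=
      (((eventually_all_finite (hX.finite_delta_eq c v)).2 h1).and hgood).exists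
    obtain ⟨t, ht, ht'⟩ := exists_btw (hvle _ (hPR h3))
    exact h2 t ht (R.flow_iff.2 ht')
  let J : Set B := ⋃ i, cs.conjSet (I i) ((u i)⁻¹ * v)
  have hflow : ∀ᶠ R in toward ξ, X.Flow R.1 c t ∧
      ∀ i, X.projRes (z i) R = z i ∧ X.Flow R.1 c (d i) := ht.and hgood
  have hdt : ∀ i, Btw c (d i) t := by
    intro i
    obtain ⟨R, h1, h2⟩ := hflow.exists
    have h3 := (R.flow_iff.1 h1)
    obtain ⟨t', ht', hb⟩ := exists_btw (X := X) (C := c) (E := t) (u := u i)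
      (by rw [htv]; exact (hvP i).1)
    have h4 : Btw c t' (X.gate R.1 c) := (h3.trans_left hb).1
    rwa [((h2 i).2 _ (R.gate_mem c)).unique h4 ht'.symm]
  have hdtd : ∀ i, X.delta (d i) t = (u i)⁻¹ * v := fun i => by
    rw [(hdt i).delta_right, htv]
  have hparJ : ∀ {w : W}, cs.Red v w → (∀ i, cs.Par (I i) ((u i)⁻¹ * v * w)) →
      cs.Par J w := by
    intro w hr h k hk
    obtain ⟨i, hi⟩ := Set.mem_iUnion.1 hk
    refine (hvP i).2.of_mul (h i) ?_ k hi
    have h1 : v = u i * ((u i)⁻¹ * v) := by group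
    rw [h1] at hr
    exact (Red.assoc_right (hvP i).1 hr).1
  have hconjJ : ∀ {w : W} {K : Set B}, (∀ i, cs.ConjInto (I i) ((u i)⁻¹ * v * w) K) →
      cs.ConjInto J w K := by
    intro w K h
    refine conjInto_of_simple fun k hk => ?_
    obtain ⟨i, hi⟩ := Set.mem_iUnion.1 hk
    exact (hvP i).2.conjInto_conjSet (h i) _ (simple_mem_par hi)
  have hJR : ∀ {R : X.Res} {K : Set B}, X.IsRes K R.1 → X.Flow R.1 c t →
      (∀ i, X.projRes (z i) R = z i ∧ X.Flow R.1 c (d i)) →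
      cs.Par J (X.delta t (X.gate R.1 c)) ∧ cs.ConjInto J (X.delta t (X.gate R.1 c)) K := by
    intro R K hK h1 h2
    have hb := h1 _ (R.gate_mem c)
    have e : ∀ i, (u i)⁻¹ * v * X.delta t (X.gate R.1 c) = X.delta (d i) (X.gate R.1 c) := by
      intro i
      rw [hb.delta_right, htv, hdel (h2 i).2]
      group
    refine ⟨hparJ (htv ▸ hb.red) fun i => ?_, hconjJ fun i => ?_⟩
    · rw [e]
      exact par_of_mutual (hI i) hK (h2 i).1 (hmut (h2 i).1 (h2 i).2)
    · rw [e]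
      exact conjInto_of_mutual (hI i) hK (h2 i).1 (hmut (h2 i).1 (h2 i).2)
  have hJs : SphType cs J := by
    obtain ⟨R, h1, h2⟩ := hflow.exists
    obtain ⟨K, hKs, hK⟩ := R.exists_isRes
    exact (hJR hK h1 h2).2.sphType hKs
  let m : X.Res := ⟨X.residue J t, J, t, hJs, rfl⟩
  have hm : X.IsRes J m.1 := isRes_residue _ _
  have htm : t ∈ m.1 := mem_residue_self _ _
  have hmst : ∀ {R : X.Res}, X.Flow R.1 c t →
      (∀ i, X.projRes (z i) R = z i ∧ X.Flow R.1 c (d i)) → X.projRes m R = m := by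
    intro R h1 h2
    obtain ⟨K, -, hK⟩ := R.exists_isRes
    obtain ⟨h3, h4⟩ := hJR hK h1 h2
    refine projRes_eq_of_conjInto hm hK htm (R.gate_mem c) h3.lRed ?_ h4
    rw [← h1.gate_eq]
    exact (hK.gate_spec t).2.2
  refine ⟨m, ?_, fun i => ?_, fun y hy hzy => ?_⟩
  · obtain ⟨R, ⟨h1, h2⟩, h3⟩ := (hflow.and (eventually_projRes_eq ξ m)).exists
    rw [← h3, hmst h1 h2]
  · refine leadsTo_of_frequently (hflow.mono fun R hR => ?_).frequently
    have h3 := hR.1.of_btw_right (hdt i)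
    refine leads_of_conjInto (hI i) hm (hmst hR.1 hR.2) (hdz i) htm h3 ?_ ?_
    · rw [hdtd]
      exact (hvP i).2
    · rw [hdtd]
      exact (hvP i).2.conjInto.mono_right (Set.subset_iUnion_of_subset i subset_rfl)
  · refine leadsTo_of_frequently (Eventually.frequently ?_)
    have h1 : ∀ᶠ R in toward ξ, ∀ i, X.Leads R (z i) y :=
      eventually_all.2 fun i => eventually_leads hX (hzy i)
    filter_upwards [hflow, h1, eventually_projRes_eq ξ y] with R hR hly hyR
    rw [hy] at hyR
    obtain ⟨L, -, hL⟩ := y.exists_isRes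
    set e := X.gate y.1 c with he
    have hey : e ∈ y.1 := y.gate_mem c
    have hgy : ∀ i, X.gate y.1 (d i) = e := fun i =>
      (gate_eq_of_flow hyR (y.gate_mem _) ((hR.2 i).2.trans (hly i _ (hdz i)))).symm
    have hde : ∀ i, X.Flow R.1 (d i) e := fun i => by
      have := hly i _ (hdz i)
      rwa [hgy] at this
    obtain ⟨i₀⟩ := ‹Nonempty ι›
    have hce : X.Flow R.1 c e := (hR.2 i₀).2.trans (hde i₀)
    have hmy : ∀ i, X.Mutual (z i).1 y.1 (d i) e := by
      intro i
      have h2 := (hmut (hR.2 i).1 (hR.2 i).2).2.2.1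
      refine ⟨hdz i, hey, ?_, hgy i⟩
      rw [← h2]
      refine (z i).gate_eq_of_btw ?_
      rw [h2]
      exact (hde i _ (R.gate_mem c)).symm
    have hzy' : ∀ i, X.projRes (z i) y = z i := by
      intro i
      have h2 := projRes_eq_of_leads (σ := z i) hyR (by rw [(hR.2 i).1]; exact hly i)
      exact h2.trans (hR.2 i).1
    have hde' : ∀ i, X.delta (d i) e = (u i)⁻¹ * X.delta c e := fun i =>
      ((hR.2 i).2.btw (hde i)).delta_right
    obtain ⟨t', ht', hb⟩ := exists_btw (hvle (X.delta c e) fun i =>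
      ⟨((hR.2 i).2.btw (hde i)).wle, by
        rw [← hde']
        exact par_of_mutual (hI i) hL (hzy' i) (hmy i)⟩)
    have htt : t' = t :=
      ((hce _ (R.gate_mem c)).trans_left hb).1.unique (hR.1 _ (R.gate_mem c)) (ht'.trans htv.symm)
    rw [htt] at hb
    have hte : ∀ i, (u i)⁻¹ * v * X.delta t e = X.delta (d i) e := by
      intro i
      rw [hb.delta_right, hde', htv]
      group
    refine leads_of_conjInto hm hL hyR htm hey (hce.of_btw_right hb)
      (hparJ (htv ▸ hb.red) fun i => ?_) (hconjJ fun i => ?_)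
    · rw [hte]
      exact par_of_mutual (hI i) hL (hzy' i) (hmy i)
    · rw [hte]
      exact conjInto_of_mutual (hI i) hL (hzy' i) (hmy i)

end Bldg

namespace CoxeterSystem

variable {cs : CoxeterSystem M W}

theorem Par.conjInto_inv {H : Set B} {w : W} (h : cs.Par H w) :
    cs.ConjInto (cs.conjSet H w) w⁻¹ H := by
  intro x hx
  rw [inv_inv]
  exact h.mem_par_conjSet.1 hx

theorem Par.conjSet_conjSet {H : Set B} {w v : W} (h : cs.Par H w) :
    cs.conjSet (cs.conjSet H w) v = cs.conjSet H (w * v) := by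
  ext k
  constructor
  · rintro ⟨l, ⟨j, hj, e⟩, e'⟩
    exact ⟨j, hj, by rw [← mul_assoc, e, mul_assoc, e', mul_assoc]⟩
  · rintro ⟨j, hj, e⟩
    obtain ⟨-, l, e'⟩ := h j hj
    refine ⟨l, ⟨j, hj, e'⟩, ?_⟩
    apply mul_left_cancel (a := w)
    rw [← mul_assoc, ← e', mul_assoc, e, mul_assoc]

/-- The transporter obtained from the longest elements of `W_H` and `W_J`, for `H ⊆ J`. -/
theorem IsLongest.par {H J : Set B} {a b : W} (hb : cs.IsLongest H b) (ha : cs.IsLongest J a)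
    (hHJ : H ⊆ J) : cs.Par H (b⁻¹ * a) := by
  have hr : cs.Red b (b⁻¹ * a) := ha.2 b (par_mono hHJ hb.1)
  intro j hj
  constructor
  · obtain ⟨k, hk, e⟩ := hb.conj_simple hj
    have h1 : b⁻¹ * cs.simple k * b = cs.simple j := by
      have h2 := hb.inv_eq
      have h3 : b * b = 1 := by
        nth_rw 1 [← h2]
        exact inv_mul_cancel b
      rw [h2, ← e, mul_assoc, h3, mul_one]
    rw [← h1]
    exact (cs.red_iff_disjoint).1 hr _ (hb.mem_leftInv hk)
  · obtain ⟨k, hk, e⟩ := hb.conj_simple hj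
    obtain ⟨l, -, e'⟩ := ha.conj_simple (hHJ hk)
    refine ⟨l, ?_⟩
    rw [hb.inv_eq, ← mul_assoc, e, mul_assoc, e', mul_assoc]

/-- A transporter having a left descent `s` starts with an elementary transporter of type
`insert s H`. -/
theorem Par.exists_factor {H : Set B} {w v : W} (hH : SphType cs H) (hw : cs.Par H w)
    (hr : cs.Red w v) (hl : cs.LRed H (w * v)) {s : B} (hs : cs.simple s ∈ cs.leftInv w) :
    ∃ a u q, cs.IsLongest (insert s H) a ∧ w = u * q ∧ u ∈ cs.par (insert s H) ∧ u ≠ 1 ∧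
      cs.Par H u ∧ cs.Red u q ∧ cs.Red u (q * v) ∧ cs.LRed (insert s H) q ∧
      cs.LRed (insert s H) (q * v) := by
  obtain ⟨b, hb⟩ := exists_isLongest_of_finite (cs := cs) hH
  have hbw : cs.leftInv w ⊆ cs.leftInv (b * w) := by
    have h1 : b * w = w * (w⁻¹ * b * w) := by group
    rw [h1]
    exact (hw.rRed _ (hw.conjInto b hb.1)).subset
  have h1 := hr.assoc_left (hl b hb.1)
  have hJ : ∀ j ∈ insert s H, cs.simple j ∈ cs.leftInv (b * w) := by
    rintro j (rfl | hj)
    · exact hbw hs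
    · exact h1.1.subset (hb.mem_leftInv hj)
  obtain ⟨a, ha, q, e, hq⟩ := exists_isLongest hJ
  obtain ⟨a', ha', q', e', hq'⟩ := exists_isLongest fun j hj => h1.2.subset (hJ j hj)
  obtain rfl := ha.unique ha'
  obtain rfl : q * v = q' := by
    apply mul_left_cancel (a := a)
    rw [← e', e, mul_assoc]
  have hba : cs.Red b (b⁻¹ * a) := ha.2 b (par_mono (Set.subset_insert _ _) hb.1)
  have hbb : b * (b⁻¹ * a) = a := mul_inv_cancel_left b a
  have hwq : w = b⁻¹ * a * q := by rw [mul_assoc, ← e, inv_mul_cancel_left]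
  refine ⟨a, b⁻¹ * a, q, ha, hwq, ?_, ?_, hb.par ha (Set.subset_insert _ _), ?_, ?_, hq, hq'⟩
  · exact mul_mem (inv_mem (par_mono (Set.subset_insert _ _) hb.1)) ha.1
  · intro h
    rw [h, one_mul] at hwq
    exact hq.simple (Set.mem_insert s H) (hwq ▸ hs)
  · exact (hba.assoc_right (by rw [hbb]; exact hq a ha.1)).1
  · exact (hba.assoc_right (by rw [hbb]; exact hq' a ha.1)).1

theorem par_conjSet_one (H : Set B) : cs.par (cs.conjSet H 1) = cs.par H := by
  ext x
  rw [mem_par_conjSet fun j _ => ⟨j, by simp⟩]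
  simp

end CoxeterSystem

namespace Bldg

open CoxeterSystem

variable {cs : CoxeterSystem M W} {X : Bldg cs}

theorem mem_of_convex [Finite B] {𝓡 : Set X.Res} (h𝓡 : X.ConvexResSet 𝓡) {R : X.Res}
    (hR : R ∈ 𝓡) {H : Set B} {x y : X.Res} {c d : X.Chamber} (hx : X.IsRes H x.1) (hc : c ∈ x.1)
    (hx𝓡 : x ∈ 𝓡) (hb : Btw c d (X.gate R.1 c)) (hl : cs.LRed H (X.delta c (X.gate R.1 c)))
    (hp : cs.Par H (X.delta c d)) (hH : SphType cs H)
    (hy : X.IsRes (cs.conjSet H (X.delta c d)) y.1) (hd : d ∈ y.1) : y ∈ 𝓡 := by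
  induction hn : X.gdist c d using Nat.strong_induction_on generalizing H x c with
  | _ n ih =>
  subst hn
  by_cases hcd : c = d
  · subst hcd
    rw [delta_self] at hy
    convert hx𝓡
    apply Subtype.ext
    rw [hx.eq_residue hc, hy.eq_residue hd]
    ext E
    simp only [mem_residue]
    rw [par_conjSet_one]
  set C := X.gate R.1 c with hC
  have hw1 : X.delta c d ≠ 1 := fun h => hcd ((X.delta_eq_one_iff _ _).1 h)
  obtain ⟨s, hs⟩ : ∃ s, cs.simple s ∈ cs.leftInv (X.delta c d) := by
    obtain ⟨i, h⟩ := cs.exists_leftDescent_of_ne_one hw1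
    exact ⟨i, cs.simple_mem_leftInv.2 h⟩
  have hwv := hb.delta_eq
  obtain ⟨a, u, q, ha, hwq, huJ, hu1, hHu, huq, huqv, hq, hqv⟩ :=
    hp.exists_factor hH hb.red (by rw [← hwv]; exact hl) hs
  set J := insert s H with hJ
  have hHJ : H ⊆ J := Set.subset_insert _ _
  obtain ⟨c', hc', hcc'd⟩ : ∃ c', X.delta c c' = u ∧ Btw c c' d := exists_btw (by
    rw [hwq]; exact huq.wle)
  have hcc' := hb.trans_left hcc'd
  let ρ : X.Res := ⟨X.residue J c, J, c, ha.finite, rfl⟩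
  have hρ : X.IsRes J ρ.1 := isRes_residue _ _
  have hρ𝓡 : ρ ∈ 𝓡 := h𝓡.1 ρ x (by
    intro E hE
    exact par_mono hHJ (hx.delta_mem hc hE)) hx𝓡
  set x₁ := X.projRes ρ R with hx₁
  have hx₁𝓡 : x₁ ∈ 𝓡 := h𝓡.2 _ hρ𝓡 _ hR
  have hc'ρ : c' ∈ ρ.1 := by
    change X.delta c c' ∈ cs.par J
    rw [hc']; exact huJ
  have hdc'd : X.delta c' d = q := by rw [hcc'd.delta_right, hc', hwq]; group
  have hdc'C : X.delta c' C = q * X.delta d C := by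
    rw [hcc'.1.delta_right, hc', hwv, hwq]; group
  have hgC : X.gate ρ.1 C = c' := gate_eq_of_rRed hρ hc'ρ (by
    rw [delta_symm, ← lRed_iff, hdc'C]
    exact hqv)
  have hCR : C ∈ R.1 := R.gate_mem c
  have hc'x₁ : c' ∈ x₁.1 := mem_projRes.2 ⟨C, hCR, hgC⟩
  have hflow : X.Flow R.1 c c' := R.flow_iff.2 hcc'.1
  have hx₁R : X.projRes x₁ R = x₁ := projRes_projRes ρ R
  have hgx₁ : X.gate x₁.1 c = c' := gate_eq_of_flow hx₁R hc'x₁ hflow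
  have hgx : X.gate x.1 c' = c := gate_eq_of_rRed hx hc (by
    rw [delta_symm, ← lRed_iff, hc']
    exact hHu.lRed)
  obtain ⟨U, -, hU⟩ := x₁.exists_isRes
  have hmut : X.Mutual x₁.1 x.1 c' c := ⟨hc'x₁, hc, hgx₁, hgx⟩
  have hproj := hmut.projSet_eq hU hx
  have hc'c : X.delta c' c = u⁻¹ := by rw [delta_symm, hc']
  have hVs : SphType cs (cs.conjSet H u) := hHu.conjInto_inv.sphType hH
  let V : X.Res := ⟨X.residue (cs.conjSet H u) c', _, c', hVs, rfl⟩
  have hV𝓡 : V ∈ 𝓡 := by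
    refine h𝓡.1 V (X.projRes x₁ x) ?_ (h𝓡.2 _ hx₁𝓡 _ hx𝓡)
    change (X.projRes x₁ x).1 ⊆ _
    rw [projRes_val, hproj]
    refine residue_mono (par_mono ?_) _
    rintro i ⟨-, k, hk, e⟩
    refine ⟨k, hk, ?_⟩
    rw [hc'c] at e
    calc cs.simple k * u = u * (u⁻¹ * cs.simple k) * u := by group
      _ = u * cs.simple i := by rw [← e]; group
  have hgR : X.gate R.1 c' = C := hflow.gate_eq
  refine ih _ ?_ (H := cs.conjSet H u) (x := V) (c := c') (isRes_residue _ _)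
    (mem_residue_self _ _) hV𝓡 ?_ ?_ ?_ hVs ?_ rfl
  · have h1 := hcc'd
    have h2 : X.gdist c c' ≠ 0 := by
      rw [Ne, gdist_eq_zero]
      rintro rfl
      rw [delta_self] at hc'
      exact hu1 hc'.symm
    rw [Btw] at h1
    omega
  · rw [hgR]; exact hcc'.2
  · rw [hgR, hdc'C]
    refine hqv.mono fun z hz => ?_
    rw [hHu.mem_par_conjSet] at hz
    have := mul_mem (mul_mem (inv_mem huJ) (par_mono hHJ hz)) huJ
    simpa [mul_assoc] using this
  · rw [hdc'd]
    exact hHu.of_mul (hwq ▸ hp) huq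
  · rw [hdc'd, hHu.conjSet_conjSet, ← hwq]
    exact hy

end Bldg

namespace Bldg

open CoxeterSystem

variable {cs : CoxeterSystem M W} {X : Bldg cs}

theorem mem_of_convex_of_leads [Finite B] {𝓡 : Set X.Res} (h𝓡 : X.ConvexResSet 𝓡) {x z R : X.Res}
    (hx : x ∈ 𝓡) (hR : R ∈ 𝓡) (hz : X.projRes z R = z) (h : X.Leads R (X.projRes x R) z) :
    z ∈ 𝓡 := by
  set x₀ := X.projRes x R with hx₀
  have hx₀R : X.projRes x₀ R = x₀ := projRes_projRes x R
  obtain ⟨H, hHs, hH⟩ := x₀.exists_isRes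
  obtain ⟨K, -, hK⟩ := R.exists_isRes
  obtain ⟨L, -, hL⟩ := z.exists_isRes
  obtain ⟨c, hc⟩ := x₀.nonempty
  have hmut := mutual_of_mem hx₀R hc
  set d := X.gate z.1 c with hd
  have hflow := R.flow_iff.1 (h c hc)
  have hx₀z : X.projRes x₀ z = x₀ := by
    have := projRes_eq_of_leads (σ := x₀) hz (by rwa [hx₀R])
    rw [this, hx₀R]
  have hmut' : X.Mutual x₀.1 z.1 c d := by
    refine ⟨hc, z.gate_mem c, ?_, rfl⟩
    have h1 := hmut.2.2.1
    have h2 := x₀.gate_eq_of_btw (C := X.gate R.1 c) (D := d) (by rw [h1]; exact hflow.symm)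
    rw [h2, h1]
  have hp := par_of_mutual hH hL hx₀z hmut'
  have hci := conjInto_of_mutual hH hL hx₀z hmut'
  let y : X.Res := ⟨X.residue (cs.conjSet H (X.delta c d)) d, _, d,
    hp.conjInto_inv.sphType hHs, rfl⟩
  refine h𝓡.1 z y ?_ (mem_of_convex h𝓡 hR hH hc (h𝓡.2 _ hx _ hR) hflow (hmut.lRed hH) hp hHs
    (isRes_residue _ _) (mem_residue_self _ _))
  change X.residue _ d ⊆ z.1
  rw [hL.eq_residue (z.gate_mem c)]
  refine residue_mono (fun t ht => ?_) _
  rw [hp.mem_par_conjSet] at ht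
  have := hci _ ht
  simpa [mul_assoc] using this

variable {ξ : X.Res → X.Res}

theorem mem_qsector (hX : X.LocallyFinite) (hseq : ∃ R : ℕ → X.Res, X.ConvSeq ξ R) {x z : X.Res}
    (hz : ξ z = z) (h : LeadsTo ξ (ξ x) z) : z ∈ X.Qsector x ξ := by
  have := hX.1
  have h1 := tendsto_toward (Classical.epsilon_spec hseq)
  have h2 := h1.eventually ((eventually_leads hX h).and
    ((eventually_projRes_eq ξ z).and (eventually_projRes_eq ξ x)))
  obtain ⟨k, hk⟩ := eventually_atTop.1 h2
  refine Set.mem_iUnion.2 ⟨k, Set.mem_iInter₂.2 fun n hn => ?_⟩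
  obtain ⟨h3, h4, h5⟩ := hk n hn
  rintro 𝓡 ⟨h𝓡, hsub⟩
  refine mem_of_convex_of_leads h𝓡 (hsub (Or.inl rfl)) (hsub (Or.inr rfl)) (h4.trans hz) ?_
  rwa [h5]

theorem exists_common_leadsTo (hX : X.LocallyFinite) (hξ : ξ ∈ X.Cr) (x y : X.Res) :
    ∃ z, ξ z = z ∧ LeadsTo ξ x z ∧ LeadsTo ξ y z := by
  have join : ∀ (c : X.Chamber) (x y : X.Res), ξ x = x → ξ y = y →
      (∀ᶠ R in toward ξ, X.Flow R.1 c (X.gate x.1 c)) →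
      (∀ᶠ R in toward ξ, X.Flow R.1 c (X.gate y.1 c)) →
      ∃ z, ξ z = z ∧ LeadsTo ξ x z ∧ LeadsTo ξ y z := by
    intro c x y hx hy hcx hcy
    obtain ⟨m, h1, h2, -⟩ := exists_least_leadsTo hX hξ c (fun b : Bool => cond b x y)
      (by rintro (_ | _) <;> assumption) (by rintro (_ | _) <;> assumption)
    exact ⟨m, h1, h2 true, h2 false⟩
  have step : ∀ (c : X.Chamber) (x z : X.Res),
      (∀ᶠ R in toward ξ, X.Flow R.1 c (X.gate x.1 c)) → LeadsTo ξ x z →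
      ∀ᶠ R in toward ξ, X.Flow R.1 c (X.gate z.1 c) := by
    intro c x z h h'
    filter_upwards [h, h' _ (x.gate_mem c)] with R h1 h2
    exact (h1.trans h2).of_btw (z.btw_gate c (z.gate_mem _))
  have chambers : ∀ (n : ℕ) (c d : X.Chamber), X.gdist c d = n → ∃ z, ξ z = z ∧
      (∀ᶠ R in toward ξ, X.Flow R.1 c (X.gate z.1 c)) ∧
      (∀ᶠ R in toward ξ, X.Flow R.1 d (X.gate z.1 d)) := by
    intro n
    induction n with
    | zero =>
      intro c d hcd
      obtain rfl := gdist_eq_zero.1 hcd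
      let P : X.Res := ⟨X.residue ∅ c, ∅, c, by simp [SphType], rfl⟩
      exact ⟨ξ P, xi_xi hξ P, leadsTo_xi hξ P c (mem_residue_self _ _),
        leadsTo_xi hξ P c (mem_residue_self _ _)⟩
    | succ n ih =>
      intro c d hcd
      obtain ⟨e, i, h1, h2, h3⟩ := X.exists_last c (D := d) (by rintro rfl; simp at hcd)
      obtain ⟨z, hz, hcz, hez⟩ := ih c e (by
        rw [gdist, h2, h3, length_simple] at hcd
        rw [gdist]
        omega)
      let P : X.Res := ⟨X.residue {i} e, {i}, e, sphType_singleton i, rfl⟩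
      have hP := leadsTo_xi hξ P
      obtain ⟨m, hm, h4, h5⟩ := join e z (ξ P) hz (xi_xi hξ P) hez (hP e (mem_residue_self _ _))
      refine ⟨m, hm, step c z m hcz h4, step d _ m (hP d ?_) h5⟩
      change X.delta e d ∈ cs.par {i}
      rw [h1]
      exact simple_mem_par rfl
  obtain ⟨c, hc⟩ := x.nonempty
  obtain ⟨d, hd⟩ := y.nonempty
  obtain ⟨z, hz, hcz, hdz⟩ := chambers _ c d rfl
  obtain ⟨m, hm, hxm, hzm⟩ := join c (ξ x) z (xi_xi hξ x) hz (leadsTo_xi hξ x c hc) hcz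
  obtain ⟨m', hm', hym, hmm⟩ := join d (ξ y) m (xi_xi hξ y) hm (leadsTo_xi hξ y d hd)
    (step d z m hdz hzm)
  exact ⟨m', hm', ((leadsTo_xi hξ x).trans hxm).trans hmm, (leadsTo_xi hξ y).trans hym⟩

theorem exists_leadsTo_of_finite (hX : X.LocallyFinite) (hξ : ξ ∈ X.Cr) {s : Set X.Res}
    (hs : s.Finite) : ∃ z, ξ z = z ∧ ∀ x ∈ s, LeadsTo ξ x z := by
  induction s, hs using Set.Finite.induction_on with
  | empty => exact ⟨ξ (Classical.arbitrary _), xi_xi hξ _, by simp⟩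
  | @insert a s _ _ ih =>
    obtain ⟨z, hz, h⟩ := ih
    obtain ⟨m, hm, h1, h2⟩ := exists_common_leadsTo hX hξ a z
    refine ⟨m, hm, ?_⟩
    rintro x (rfl | hx)
    · exact h1
    · exact (h x hx).trans h2

end Bldg

namespace Bldg

open CoxeterSystem

variable {cs : CoxeterSystem M W} {X : Bldg cs} {ξ : X.Res → X.Res}

/-! ### Stabilisers -/

theorem tendsto_actRes_toward {g : X.Aut} (hg : X.actCr g ξ = ξ) :
    Tendsto (X.actRes g) (toward ξ) (toward ξ) := by
  refine tendsto_comap_iff.2 (tendsto_pi_nhds.2 fun σ => ?_)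
  rw [nhds_discrete, tendsto_pure]
  filter_upwards [eventually_projRes_eq ξ (X.actRes g⁻¹ σ)] with R hR
  have h := actRes_projRes g (X.actRes g⁻¹ σ) R
  rw [actRes_actRes_inv, hR, ← actCr_eq_iff.1 hg, actRes_actRes_inv] at h
  exact h.symm

theorem LeadsTo.act {g : X.Aut} (hg : X.actCr g ξ = ξ) {x z : X.Res} (h : LeadsTo ξ x z) :
    LeadsTo ξ (X.actRes g x) (X.actRes g z) := by
  intro c' hc'
  rw [actRes_val] at hc'
  obtain ⟨c, hc, rfl⟩ := hc'
  filter_upwards [(tendsto_actRes_toward (actCr_inv hg)).eventually (h c hc)] with R hR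
  rw [actRes_val, z.gate_act]
  have := (flow_act (g := g)).2 hR
  rwa [actRes_actRes_inv] at this

theorem Leads.mutual {x z R : X.Res} (hx : X.projRes x R = x) (h : X.Leads R x z)
    {c : X.Chamber} (hc : c ∈ x.1) : X.Mutual x.1 z.1 c (X.gate z.1 c) := by
  refine ⟨hc, z.gate_mem c, ?_, rfl⟩
  have h1 := (mutual_of_mem hx hc).2.2.1
  have h2 := x.gate_eq_of_btw (C := X.gate R.1 c) (D := X.gate z.1 c)
    (by rw [h1]; exact (R.flow_iff.1 (h c hc)).symm)
  rw [h2, h1]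

theorem actRes_eq_of_leadsTo (hX : X.LocallyFinite) (hξ : ξ ∈ X.Cr) {g : X.Aut}
    (hg : X.actCr g ξ = ξ) {x z : X.Res} (hx : X.actRes g x = x) (h : LeadsTo ξ x z) :
    X.actRes g z = z := by
  have := toward_neBot hξ
  obtain ⟨H, -, hH⟩ := (ξ x).exists_isRes
  obtain ⟨L, -, hL⟩ := z.exists_isRes
  have hgL : X.IsRes L (X.actRes g z).1 := by
    rw [actRes_val]
    exact hL.image g
  have hgx : X.actRes g (ξ x) = ξ x := by rw [← actCr_eq_iff.1 hg, hx]
  have h1 : LeadsTo ξ (ξ x) z := leadsTo_of_subset h (xi_subset hξ x)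
  have h2 : LeadsTo ξ (ξ x) (X.actRes g z) := by
    have := h1.act hg
    rwa [hgx] at this
  obtain ⟨R, hR1, hR2, hR⟩ := ((eventually_leads hX h1).and ((eventually_leads hX h2).and
    (eventually_projRes_eq ξ (ξ x)))).exists
  rw [xi_xi hξ] at hR
  obtain ⟨c, hc⟩ := (ξ x).nonempty
  have hgc : g.1 c ∈ (ξ x).1 := by
    rw [← hgx, act_mem_actRes]
    exact hc
  have h3 := ((hR2.mutual hR hgc).delta_eq hH hgL (hR2.mutual hR hc)).1
  rw [actRes_val, z.gate_act, delta_act, ← actRes_val] at h3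
  have h4 := (hR2 c hc _ (R.gate_mem c)).unique (hR1 c hc _ (R.gate_mem c)) h3
  have h5 := (X.actRes g z).gate_mem c
  rw [h4] at h5
  apply Subtype.ext
  rw [hgL.eq_residue h5, ← hL.eq_residue (z.gate_mem c)]

theorem exists_fixed_of_finite_orbits (hX : X.LocallyFinite) (hξ : ξ ∈ X.Cr) {g : X.Aut}
    (hg : X.actCr g ξ = ξ) (hfin : ∀ c, (Set.range fun n : ℤ => (g ^ n).1 c).Finite) :
    ∃ z, X.actRes g z = z := by
  have hgn : ∀ n : ℤ, X.actCr (g ^ n) ξ = ξ := by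
    intro n
    induction n with
    | zero => simpa using actCr_one ξ
    | succ n ih =>
      rw [zpow_add_one]
      exact actCr_mul ih hg
    | pred n ih =>
      rw [zpow_sub_one]
      exact actCr_mul ih (actCr_inv hg)
  obtain ⟨c⟩ := X.chamber_nonempty
  let P : X.Chamber → X.Res := fun d => ⟨X.residue ∅ d, ∅, d, by simp [SphType], rfl⟩
  obtain ⟨z, hz, hPz⟩ := exists_leadsTo_of_finite hX hξ ((hfin c).image P)
  let S : Set X.Res := Set.range fun n : ℤ => X.actRes (g ^ n) z
  have hS : S.Finite := by
    have h1 : (⋃ d ∈ z.1, Set.range fun n : ℤ => (g ^ n).1 d).Finite :=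
      (hX.finite_res z).biUnion fun d _ => hfin d
    refine Set.Finite.of_finite_image (f := Subtype.val) (h1.finite_subsets.subset ?_)
      Subtype.val_injective.injOn
    rintro _ ⟨_, ⟨n, rfl⟩, rfl⟩
    change (X.actRes (g ^ n) z).1 ⊆ _
    rw [actRes_val]
    rintro _ ⟨d, hd, rfl⟩
    exact Set.mem_biUnion hd ⟨n, rfl⟩
  have : Finite S := hS
  have : Nonempty S := ⟨_, 0, rfl⟩
  obtain ⟨m, hm, h1, h2⟩ := exists_least_leadsTo hX hξ c (fun i : S => i.1) (by
    rintro ⟨_, n, rfl⟩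
    change ξ (X.actRes (g ^ n) z) = _
    rw [actCr_eq_iff.1 (hgn n), hz]) (by
    rintro ⟨_, n, rfl⟩
    refine ((hPz _ ⟨_, ⟨-n, rfl⟩, rfl⟩).act (hgn n)) c ?_
    have h3 : (g ^ n).1 ((g ^ (-n)).1 c) = c := by
      rw [zpow_neg]
      exact (g ^ n).1.apply_symm_apply c
    rw [← h3]
    exact act_mem_actRes.2 (by rw [h3]; exact mem_residue_self _ _))
  have key : ∀ k : ℤ, LeadsTo ξ m (X.actRes (g ^ k) m) := by
    intro k
    refine h2 _ (by rw [actCr_eq_iff.1 (hgn k), hm]) ?_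
    rintro ⟨_, n, rfl⟩
    have h3 := (h1 ⟨_, n - k, rfl⟩).act (hgn k)
    rw [← actRes_mul, ← zpow_add, add_sub_cancel] at h3
    exact h3
  refine ⟨m, ?_⟩
  have h3 := key 1
  have h4 := (key (-1)).act hg
  rw [← actRes_mul, ← zpow_one_add, add_neg_cancel, zpow_zero, actRes_one] at h4
  rw [zpow_one] at h3
  exact h4.antisymm hX hξ (by rw [actCr_eq_iff.1 hg, hm]) hm h3

/-! ### Compactness -/

instance : T2Space X.Aut :=
  T2Space.of_injective_continuous
    (f := fun g : X.Aut => (g.1 : X.Chamber → X.Chamber))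
    (fun _ _ h => Subtype.ext (Equiv.coe_fn_injective h)) continuous_induced_dom

theorem continuous_apply_chamber (c : X.Chamber) : Continuous fun g : X.Aut => g.1 c :=
  (continuous_apply c).comp continuous_induced_dom

theorem bijective_of_delta_eq (hX : X.LocallyFinite) {z : X.Res} {f : X.Chamber → X.Chamber}
    (hf : ∀ C D, X.delta (f C) (f D) = X.delta C D) (hz : Set.MapsTo f z.1 z.1) :
    Function.Bijective f := by
  have hinj : Function.Injective f := fun C D h => by
    rw [← X.delta_eq_one_iff, ← hf, h, delta_self]
  refine ⟨hinj, fun E => ?_⟩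
  obtain ⟨c, hc⟩ := z.nonempty
  have : Finite z.1 := hX.finite_res z
  obtain ⟨k, hk, hck⟩ := Function.Injective.mem_periodicPts (f := hz.restrict)
    (hz.restrict_inj.2 hinj.injOn) ⟨c, hc⟩
  have hck' : f^[k] c = c := by
    have := congrArg Subtype.val hck
    rwa [hz.iterate_restrict] at this
  have hiter : ∀ k C D, X.delta (f^[k] C) (f^[k] D) = X.delta C D := by
    intro k
    induction k with
    | zero => simp
    | succ k ih =>
      intro C D
      rw [Function.iterate_succ_apply, Function.iterate_succ_apply, ih, hf]
  have hmaps : Set.MapsTo f^[k] {D | X.delta c D = X.delta c E} {D | X.delta c D = X.delta c E} := by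
    intro D hD
    change X.delta c _ = _
    nth_rw 1 [← hck']
    rw [hiter]
    exact hD
  have : Finite {D | X.delta c D = X.delta c E} := hX.finite_delta_eq c _
  have hsurj := Finite.surjective_of_injective (hmaps.restrict_inj.2 (hinj.iterate k).injOn)
  obtain ⟨D, hD⟩ := hsurj ⟨E, rfl⟩
  have hD' : f^[k] D.1 = E := congrArg Subtype.val hD
  obtain ⟨k, rfl⟩ := Nat.exists_eq_succ_of_ne_zero hk.ne'
  rw [Function.iterate_succ_apply'] at hD'
  exact ⟨_, hD'⟩

theorem isCompact_stab (hX : X.LocallyFinite) (z : X.Res) :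
    IsCompact {g : X.Aut | X.actRes g z = z} := by
  have hind : IsInducing fun g : X.Aut => (g.1 : X.Chamber → X.Chamber) := ⟨rfl⟩
  rw [hind.isCompact_iff]
  obtain ⟨c, hc⟩ := z.nonempty
  let K : X.Chamber → Set X.Chamber := fun D => ⋃ e ∈ z.1, {E | X.delta e E = X.delta c D}
  have hK : ∀ D, IsCompact (K D) := fun D =>
    ((hX.finite_res z).biUnion fun e _ => hX.finite_delta_eq e _).isCompact
  let T : Set (X.Chamber → X.Chamber) :=
    (⋂ p : X.Chamber × X.Chamber, {f | X.delta (f p.1) (f p.2) = X.delta p.1 p.2}) ∩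
      ⋂ C ∈ z.1, {f | f C ∈ z.1}
  have hT : IsClosed T := by
    refine (isClosed_iInter fun p => ?_).inter (isClosed_biInter fun C _ => ?_)
    · have hcont : Continuous fun f : X.Chamber → X.Chamber => (f p.1, f p.2) := by fun_prop
      exact (isClosed_discrete
        {q : X.Chamber × X.Chamber | X.delta q.1 q.2 = X.delta p.1 p.2}).preimage hcont
    · exact (isClosed_discrete z.1).preimage (continuous_apply C)
  have hTK : T ⊆ Set.pi Set.univ K := by
    rintro f ⟨h1, h2⟩ D -
    exact Set.mem_biUnion (Set.mem_iInter₂.1 h2 c hc) (Set.mem_iInter.1 h1 (c, D))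
  convert (isCompact_univ_pi hK).of_isClosed_subset hT hTK using 1
  ext f
  constructor
  · rintro ⟨g, hg, rfl⟩
    refine ⟨Set.mem_iInter.2 fun p => delta_act g _ _, Set.mem_iInter₂.2 fun C hC => ?_⟩
    change g.1 C ∈ z.1
    have hg' : X.actRes g z = z := hg
    rw [← hg', act_mem_actRes]
    exact hC
  · rintro ⟨h1, h2⟩
    have hf : ∀ C D, X.delta (f C) (f D) = X.delta C D := fun C D => Set.mem_iInter.1 h1 (C, D)
    have hz : Set.MapsTo f z.1 z.1 := fun C hC => Set.mem_iInter₂.1 h2 C hC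
    have hb := bijective_of_delta_eq hX hf hz
    refine ⟨⟨Equiv.ofBijective f hb, hf⟩, ?_, rfl⟩
    apply Subtype.ext
    rw [actRes_val]
    refine Set.eq_of_subset_of_ncard_le hz.image_subset ?_ (hX.finite_res z)
    exact (Set.ncard_image_of_injective _ hb.1).ge

end Bldg

namespace Bldg

open CoxeterSystem

variable {cs : CoxeterSystem M W} {X : Bldg cs} {ξ : X.Res → X.Res}

variable (X) in
/-- The stabiliser of a residue. -/
def stabRes (G : Subgroup X.Aut) (z : X.Res) : Subgroup G where
  carrier := {g | X.actRes g z = z}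
  one_mem' := actRes_one z
  mul_mem' := by
    intro a b ha hb
    change X.actRes (a.1 * b.1) z = z
    rw [actRes_mul, hb, ha]
  inv_mem' := by
    intro a ha
    change X.actRes a.1⁻¹ z = z
    nth_rw 1 [← show X.actRes a.1 z = z from ha]
    exact actRes_inv_actRes _ _

theorem mem_stabRes {G : Subgroup X.Aut} {z : X.Res} {g : G} :
    g ∈ X.stabRes G z ↔ X.actRes g z = z := Iff.rfl

theorem isCompact_stabRes (hX : X.LocallyFinite) {G : Subgroup X.Aut}
    (hG : IsClosed (G : Set X.Aut)) (z : X.Res) : IsCompact (X.stabRes G z : Set G) :=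
  hG.isClosedEmbedding_subtypeVal.isCompact_preimage (isCompact_stab hX z)

theorem isCompact_closure_of_le_stabRes (hX : X.LocallyFinite) {G : Subgroup X.Aut}
    (hG : IsClosed (G : Set X.Aut)) {z : X.Res} {K : Subgroup G} (h : K ≤ X.stabRes G z) :
    IsCompact (closure (K : Set G)) :=
  (isCompact_stabRes hX hG z).closure_of_subset h

theorem mem_periodicStab_iff (hX : X.LocallyFinite) {G : Subgroup X.Aut}
    (hG : IsClosed (G : Set X.Aut)) (hξ : ξ ∈ X.Cr) {g : G} :
    g ∈ X.periodicStab G ξ ↔ X.actCr g ξ = ξ ∧ ∃ z, g ∈ X.stabRes G z := by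
  refine and_congr_right fun hg => ⟨fun h => ?_, fun ⟨z, hz⟩ => ?_⟩
  · refine exists_fixed_of_finite_orbits hX hξ hg fun c => ?_
    have h1 := h.image ((continuous_apply_chamber (X := X) c).comp continuous_subtype_val)
    refine (isCompact_iff_finite.1 h1).subset ?_
    rintro _ ⟨n, rfl⟩
    exact ⟨g ^ n, subset_closure ⟨n, rfl⟩, by simp⟩
  · exact isCompact_closure_of_le_stabRes hX hG ((Subgroup.zpowers_le).2 hz)

theorem actRes_eq_of_mem_qsector (hX : X.LocallyFinite) (hξ : ξ ∈ X.Cr)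
    (hseq : ∃ R : ℕ → X.Res, X.ConvSeq ξ R) {g : X.Aut} (hg : X.actCr g ξ = ξ) {x : X.Res}
    (hx : X.actRes g x = x) : ∀ R ∈ X.Qsector x ξ, X.actRes g R = R :=
  fun _ hR => actRes_eq_of_leadsTo hX hξ hg hx (LeadsTo.of_mem_qsector hseq hR)

theorem actCr_eq_of_fix_qsector (hX : X.LocallyFinite) (hξ : ξ ∈ X.Cr)
    (hseq : ∃ R : ℕ → X.Res, X.ConvSeq ξ R) {g : X.Aut} {x : X.Res}
    (h : ∀ R ∈ X.Qsector x ξ, X.actRes g R = R) :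
    X.actCr g ξ = ξ ∧ ∃ z, X.actRes g z = z := by
  have key : ∀ σ, ∃ z, X.actRes g z = z ∧ ξ z = z ∧ LeadsTo ξ (ξ σ) z ∧
      LeadsTo ξ (ξ (X.actRes g σ)) z := by
    intro σ
    obtain ⟨z, hz, hl⟩ := exists_leadsTo_of_finite hX hξ
      (Set.toFinite ({ξ x, ξ σ, ξ (X.actRes g σ)} : Set X.Res))
    simp only [Set.mem_insert_iff, Set.mem_singleton_iff, forall_eq_or_imp, forall_eq] at hl
    exact ⟨z, h z (mem_qsector hX hseq hz hl.1), hz, hl.2⟩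
  refine ⟨actCr_eq_iff.2 fun σ => ?_, ?_⟩
  · obtain ⟨z, hgz, hz, h1, h2⟩ := key σ
    rw [← projRes_eq_xi hX hξ hz h2, ← projRes_eq_xi hX hξ hz h1, actRes_projRes, hgz]
  · obtain ⟨z, hgz, -⟩ := key x
    exact ⟨z, hgz⟩

theorem exists_common_fixed (hX : X.LocallyFinite) (hξ : ξ ∈ X.Cr) {G : Subgroup X.Aut}
    (hG : IsClosed (G : Set X.Aut)) {s : Set G} (hs : s.Finite) (h : s ⊆ X.periodicStab G ξ) :
    ∃ z, ∀ g ∈ s, g ∈ X.stabRes G z := by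
  have hfix : ∀ g ∈ s, ∃ z, X.actRes (g : X.Aut) z = z := fun g hg =>
    ((mem_periodicStab_iff hX hG hξ).1 (h hg)).2
  choose! x hx using hfix
  obtain ⟨z, -, hz⟩ := exists_leadsTo_of_finite hX hξ (hs.image x)
  exact ⟨z, fun g hg => actRes_eq_of_leadsTo hX hξ (h hg).1 (hx g hg) (hz _ ⟨g, hg, rfl⟩)⟩

theorem IsApartMap.mem_range_of_btw {α : W → X.Chamber} (hα : X.IsApartMap α) {v w : W}
    {d : X.Chamber} (h : Btw (α v) d (α w)) : d ∈ Set.range α := by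
  have h1 : X.delta (α v) (α (v * X.delta (α v) d)) = X.delta (α v) d := by
    rw [hα.2, inv_mul_cancel_left]
  have h2 : X.delta (α (v * X.delta (α v) d)) (α w) = X.delta d (α w) := by
    rw [hα.2, h.delta_right, hα.2]
    group
  refine ⟨v * X.delta (α v) d, Btw.unique (C := α v) (E := α w) ?_ h h1⟩
  rw [btw_iff_red, h1, h2]
  exact h.red

theorem exists_liesIn_fixed (hX : X.LocallyFinite) (hξ : ξ ∈ X.Cr) {A : Set X.Chamber}
    (hA : X.IsApartment A) {R : ℕ → X.Res} (hR : ∀ n, X.LiesIn (R n) A) (hRξ : X.ConvSeq ξ R)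
    {g : X.Aut} (hg : X.actCr g ξ = ξ) {x : X.Res} (hx : X.actRes g x = x) :
    ∃ z, X.LiesIn z A ∧ X.actRes g z = z := by
  obtain ⟨α, hα, rfl⟩ := hA
  let P : X.Res := ⟨X.residue ∅ (α 1), ∅, α 1, by simp [SphType], rfl⟩
  obtain ⟨z, hz, hxz, hPz⟩ := exists_common_leadsTo hX hξ x P
  obtain ⟨n, hn⟩ := ((tendsto_toward hRξ).eventually (hPz (α 1) (mem_residue_self _ _))).exists
  obtain ⟨_, hb, ⟨w, rfl⟩⟩ := hR n
  exact ⟨z, ⟨_, z.gate_mem _, hα.mem_range_of_btw (hn _ hb)⟩,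
    actRes_eq_of_leadsTo hX hξ hg hx hxz⟩

end Bldg

/-- the set of periodic elements of `G_ξ` coincides with the union
of the pointwise fixators of the sectors pointing to `ξ`; it is a normal,
topologically locally finite subgroup of `G_ξ` containing every topologically
locally finite subgroup of `G_ξ` (hence it is the locally finite radical of
`G_ξ`); moreover it can be computed using only sectors based in a fixed
apartment containing a sequence converging to `ξ`. -/
theorem statement17 {cs : CoxeterSystem M W} (X : Bldg cs) (hlf : X.LocallyFinite)
    (G : Subgroup X.Aut) (hGc : IsClosed (G : Set X.Aut))
    (ξ : X.Res → X.Res) (hξ : ξ ∈ X.Cr) (hseq : ∃ R : ℕ → X.Res, X.ConvSeq ξ R) :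
    X.periodicStab G ξ = X.gfixSector G ξ ∧
    (∃ Hp : Subgroup ↥G, (Hp : Set ↥G) = X.periodicStab G ξ) ∧
    (∀ g : ↥G, X.actCr (g : X.Aut) ξ = ξ →
      ∀ p ∈ X.periodicStab G ξ, g * p * g⁻¹ ∈ X.periodicStab G ξ) ∧
    IsTLFSet (X.periodicStab G ξ) ∧
    (∀ K : Subgroup ↥G, (K : Set ↥G) ⊆ {g : ↥G | X.actCr (g : X.Aut) ξ = ξ} →
      IsTLFSet (K : Set ↥G) → (K : Set ↥G) ⊆ X.periodicStab G ξ) ∧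
    ∀ A : Set X.Chamber, X.IsApartment A →
      (∃ R : ℕ → X.Res, (∀ n, X.LiesIn (R n) A) ∧ X.ConvSeq ξ R) →
      X.periodicStab G ξ =
        {g : ↥G | ∃ x : X.Res, X.LiesIn x A ∧
          ∀ R ∈ X.Qsector x ξ, X.actRes (g : X.Aut) R = R} := by
  have hiff : ∀ {g : G}, g ∈ X.periodicStab G ξ ↔
      X.actCr (g : X.Aut) ξ = ξ ∧ ∃ z, g ∈ X.stabRes G z :=
    Bldg.mem_periodicStab_iff hlf hGc hξ
  have hmul : ∀ {a b : G}, a ∈ X.periodicStab G ξ → b ∈ X.periodicStab G ξ →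
      a * b ∈ X.periodicStab G ξ := by
    intro a b ha hb
    obtain ⟨z, hz⟩ := Bldg.exists_common_fixed hlf hξ hGc (Set.toFinite {a, b})
      (Set.pair_subset ha hb)
    exact hiff.2 ⟨Bldg.actCr_mul ha.1 hb.1, z, mul_mem (hz a (by simp)) (hz b (by simp))⟩
  have hfix : ∀ {g : G} {x : X.Res}, (∀ R ∈ X.Qsector x ξ, X.actRes (g : X.Aut) R = R) →
      g ∈ X.periodicStab G ξ :=
    fun h => hiff.2 (Bldg.actCr_eq_of_fix_qsector hlf hξ hseq h)
  refine ⟨?_, ⟨⟨⟨⟨X.periodicStab G ξ, hmul⟩, ?_⟩, ?_⟩, rfl⟩, ?_, ?_, ?_, ?_⟩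
  · ext g
    refine ⟨fun h => ?_, fun ⟨x, hx⟩ => hfix hx⟩
    obtain ⟨hg, z, hz⟩ := hiff.1 h
    exact ⟨z, Bldg.actRes_eq_of_mem_qsector hlf hξ hseq hg hz⟩
  · exact hiff.2 ⟨Bldg.actCr_one ξ, Classical.arbitrary _, one_mem _⟩
  · intro a ha
    obtain ⟨h, z, hz⟩ := hiff.1 ha
    exact hiff.2 ⟨Bldg.actCr_inv h, z, inv_mem hz⟩
  · intro g hg p hp
    obtain ⟨h, z, hz⟩ := hiff.1 hp
    refine hiff.2 ⟨Bldg.actCr_mul (Bldg.actCr_mul hg h) (Bldg.actCr_inv hg),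
      X.actRes (g : X.Aut) z, ?_⟩
    change X.actRes (g.1 * p.1 * g.1⁻¹) _ = _
    rw [Bldg.actRes_mul, Bldg.actRes_inv_actRes, Bldg.actRes_mul, Bldg.mem_stabRes.1 hz]
  · intro s hs
    obtain ⟨z, hz⟩ := Bldg.exists_common_fixed hlf hξ hGc s.finite_toSet hs
    exact Bldg.isCompact_closure_of_le_stabRes hlf hGc ((Subgroup.closure_le _).2 hz)
  · intro K hK hKc g hg
    have h := hKc {g} (by simpa using hg)
    rw [Finset.coe_singleton, ← Subgroup.zpowers_eq_closure] at h
    exact ⟨hK hg, h⟩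
  · rintro A hA ⟨R, hR, hRξ⟩
    ext g
    refine ⟨fun h => ?_, fun ⟨x, _, hx⟩ => hfix hx⟩
    obtain ⟨hg, z, hz⟩ := hiff.1 h
    obtain ⟨y, hy, hgy⟩ := Bldg.exists_liesIn_fixed hlf hξ hA hR hRξ hg hz
    exact ⟨y, hy, Bldg.actRes_eq_of_mem_qsector hlf hξ hseq hg hgy⟩
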